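/- Let T be a k-algebra of finite transcendence degree over k which is an integral domain, M a maximal ideal of T, K = T/M, φ : T → K the canonical surjection, D a subring of K, and A := φ^{-1}(D). If T and D are AF-domains and the localization T_M is catenarian, then A is a GAF-domain; that is, for every k-algebra B of finite transcendence degree over k and every prime ideal P of A⊗_kB with p = P∩A and q = P∩B, ht(P) = ht(p⊗_kB + A⊗_kq) + ht(P/(p⊗_kB + A⊗_kq)). -/

import Mathlib

open TensorProduct

noncomputable section

/-- Transcendence degree of the `R`-algebra `A` as a cardinal: the supremum of the
cardinalities of algebraically independent subsets of `A` over `R`. -/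
def trdegC (R A : Type*) [CommRing R] [CommRing A] [Algebra R A] : Cardinal :=
  ⨆ s : { s : Set A // AlgebraicIndependent R ((↑) : s → A) }, Cardinal.mk s.1

/-- Transcendence degree of the `R`-algebra `A`, as an extended natural number. -/
def eTrdeg (R A : Type*) [CommRing R] [CommRing A] [Algebra R A] : ℕ∞ :=
  Cardinal.toENat (trdegC R A)

/-- Height of an ideal: the infimum of the heights of the prime ideals containing it,
the height of a prime being taken in the prime spectrum ordered by inclusion. -/
def idealHt {R : Type*} [CommRing R] (I : Ideal R) : ℕ∞ :=
  ⨅ P : { P : PrimeSpectrum R // I ≤ P.asIdeal }, Order.height P.1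

/-- The extension `p[n]` of an ideal `p` of `A` to the polynomial ring
`A[X_1, ..., X_n]`. -/
def polyExt {A : Type*} [CommRing A] (n : ℕ) (p : Ideal A) : Ideal (MvPolynomial (Fin n) A) :=
  p.map (MvPolynomial.C : A →+* MvPolynomial (Fin n) A)

/-- An AF-domain over `k`: a `k`-algebra which is an integral domain such that
`ht p + t.d.(A/p) = t.d.(A)` for every prime ideal `p` of `A`. -/
def IsAFDomain (k A : Type*) [Field k] [CommRing A] [IsDomain A] [Algebra k A] : Prop :=
  ∀ p : Ideal A, p.IsPrime → idealHt p + eTrdeg k (A ⧸ p) = eTrdeg k A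

/-- A catenarian domain: `ht p + ht (q/p) = ht q` for all primes `p ⊆ q`. -/
def IsCatenarian (R : Type*) [CommRing R] : Prop :=
  ∀ p q : Ideal R, p.IsPrime → q.IsPrime → p ≤ q →
    idealHt p + idealHt (q.map (Ideal.Quotient.mk p)) = idealHt q

/-- A GAF-domain over `k`: for every `k`-algebra `B` (of finite transcendence degree)
and every prime `P` of `A ⊗[k] B` with `p = P ∩ A`, `q = P ∩ B`,
`ht P = ht (p⊗B + A⊗q) + ht (P/(p⊗B + A⊗q))`. -/
def IsGAFDomain (k A : Type) [Field k] [CommRing A] [IsDomain A] [Algebra k A] : Prop :=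
  ∀ (B : Type) (_ : CommRing B) (_ : Algebra k B), eTrdeg k B ≠ ⊤ →
    ∀ P : Ideal (A ⊗[k] B), P.IsPrime →
      ∀ p : Ideal A,
        p = P.comap (Algebra.TensorProduct.includeLeft : A →ₐ[k] A ⊗[k] B).toRingHom →
      ∀ q : Ideal B,
        q = P.comap (Algebra.TensorProduct.includeRight : B →ₐ[k] A ⊗[k] B).toRingHom →
      idealHt P =
        idealHt (p.map (Algebra.TensorProduct.includeLeft : A →ₐ[k] A ⊗[k] B).toRingHom ⊔
                 q.map (Algebra.TensorProduct.includeRight : B →ₐ[k] A ⊗[k] B).toRingHom) +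
        idealHt (P.map (Ideal.Quotient.mk
          (p.map (Algebra.TensorProduct.includeLeft : A →ₐ[k] A ⊗[k] B).toRingHom ⊔
           q.map (Algebra.TensorProduct.includeRight : B →ₐ[k] A ⊗[k] B).toRingHom)))

section Trdeg

variable {k R S : Type} [CommRing k] [CommRing R] [CommRing S] [Algebra k R] [Algebra k S]

theorem eTrdeg_eq_toENat_trdeg (k R : Type) [CommRing k] [CommRing R] [Algebra k R] :
    eTrdeg k R = Cardinal.toENat (Algebra.trdeg k R) := rfl

theorem eTrdeg_le_of_injective (f : R →ₐ[k] S) (hf : Function.Injective f) :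
    eTrdeg k R ≤ eTrdeg k S := by
  simp only [eTrdeg_eq_toENat_trdeg]
  exact OrderHomClass.mono _ (trdeg_le_of_injective f hf)

theorem eTrdeg_le_of_surjective (f : R →ₐ[k] S) (hf : Function.Surjective f) :
    eTrdeg k S ≤ eTrdeg k R := by
  simp only [eTrdeg_eq_toENat_trdeg]
  exact OrderHomClass.mono _ (trdeg_le_of_surjective f hf)

theorem AlgEquiv.eTrdeg_eq (e : R ≃ₐ[k] S) : eTrdeg k R = eTrdeg k S :=
  le_antisymm (eTrdeg_le_of_injective e.toAlgHom e.injective)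
    (eTrdeg_le_of_injective e.symm.toAlgHom e.symm.injective)

theorem AlgebraicIndependent.toENat_le_eTrdeg [Nontrivial k] {ι : Type} {x : ι → R}
    (hx : AlgebraicIndependent k x) : ENat.card ι ≤ eTrdeg k R := by
  simp only [eTrdeg_eq_toENat_trdeg]
  exact OrderHomClass.mono Cardinal.toENat hx.cardinalMk_le_trdeg

theorem IsTranscendenceBasis.enatCard_eq_eTrdeg [Nontrivial k] [NoZeroDivisors R] {ι : Type}
    {x : ι → R} (hx : IsTranscendenceBasis k x) : ENat.card ι = eTrdeg k R := by
  rw [eTrdeg_eq_toENat_trdeg, ← hx.cardinalMk_eq_trdeg]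
  rfl

theorem eTrdeg_add_eq (k R S : Type) [CommRing k] [CommRing R] [CommRing S] [Algebra k R]
    [Algebra k S] [Algebra R S] [IsScalarTower k R S] [Nontrivial k] [NoZeroDivisors S]
    [FaithfulSMul k R] [FaithfulSMul R S] : eTrdeg k R + eTrdeg R S = eTrdeg k S := by
  simp only [eTrdeg_eq_toENat_trdeg]
  rw [← trdeg_add_eq (R := k) (S := R) (A := S), map_add]

theorem eTrdeg_mvPolynomial (R σ : Type) [CommRing R] [IsDomain R] :
    eTrdeg R (MvPolynomial σ R) = ENat.card σ := by
  rw [eTrdeg_eq_toENat_trdeg, MvPolynomial.trdeg_of_isDomain]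
  simp [ENat.card]

theorem exists_algebraicIndependent_of_eTrdeg_eq [IsDomain R] [Nontrivial k] [FaithfulSMul k R]
    {n : ℕ} (h : eTrdeg k R = n) : ∃ x : Fin n → R, IsTranscendenceBasis k x := by
  obtain ⟨s, hs⟩ := exists_isTranscendenceBasis k R
  have hc := hs.enatCard_eq_eTrdeg
  have hc' : s.encard = n := hc.trans h
  have hf := Set.finite_of_encard_eq_coe hc'
  have hn : s.ncard = n := by rw [Set.ncard, hc']; rfl
  have := hf.to_subtype
  have e : Fin n ≃ s := (Finite.equivFinOfCardEq (by simpa using hn)).symm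
  exact ⟨_, hs.comp_equiv e⟩

/-- Transcendence degree drops strictly along a non-injective surjection of domains. -/
theorem eTrdeg_add_one_le [IsDomain k] [IsDomain R] [IsDomain S] [FaithfulSMul k S] (f : R →ₐ[k] S)
    (hf : Function.Surjective f) (hf' : ¬ Function.Injective f) :
    eTrdeg k S + 1 ≤ eTrdeg k R := by
  obtain ⟨s, hs⟩ := exists_isTranscendenceBasis k S
  rw [← hs.enatCard_eq_eTrdeg]
  choose g hg using hf
  have hx : AlgebraicIndependent k (fun i : s ↦ g i) :=
    .of_comp f (by convert hs.1 using 1; ext; simp [hg])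
  obtain ⟨a, ha, ha0⟩ : ∃ a, f a = 0 ∧ a ≠ 0 := by
    by_contra! h
    exact hf' ((injective_iff_map_eq_zero f).2 h)
  have htr : Transcendental (Algebra.adjoin k (Set.range fun i : s ↦ g i)) a := by
    intro halg
    refine Ideal.comap_ne_bot_of_algebraic_mem (I := RingHom.ker f) ha0 ha halg ?_
    rw [eq_bot_iff]
    rintro ⟨y, hy⟩ hy0
    have hy0 : f y = 0 := hy0
    rw [Algebra.adjoin_range_eq_range_aeval] at hy
    obtain ⟨P, rfl⟩ := hy
    have h0 : MvPolynomial.aeval (fun i : s ↦ (i : S)) P = 0 := by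
      rw [← hy0]
      change _ = f (MvPolynomial.aeval _ P)
      rw [← AlgHom.comp_apply, MvPolynomial.comp_aeval]
      simp [hg]
    have hP := hs.1.eq_zero_of_aeval_eq_zero P h0
    exact Subtype.ext (by simp [hP])
  have := ((hx.option_iff_transcendental a).2 htr).toENat_le_eTrdeg
  simpa [ENat.card, Cardinal.mk_option] using this

theorem eTrdeg_eq_zero [Algebra.IsAlgebraic k R] : eTrdeg k R = 0 := by
  rw [eTrdeg_eq_toENat_trdeg, trdeg_eq_zero, map_zero]

/-- If `S` is generated over `B` by the image of the `k`-algebra `A`, then its transcendence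
degree over `B` is at most the one of `A` over `k`. -/
theorem eTrdeg_le_of_adjoin_range_eq_top {k A B R : Type} [CommRing k] [CommRing A] [CommRing B]
    [CommRing R] [IsDomain R] [Algebra k A] [Algebra k B] [Algebra k R] [Algebra B R]
    [IsScalarTower k B R] [IsDomain k] [FaithfulSMul k R] [FaithfulSMul B R]
    (g : A →ₐ[k] R) (hg : Algebra.adjoin B (Set.range g) = ⊤) :
    eTrdeg B R ≤ eTrdeg k A := by
  refine le_trans ?_ (eTrdeg_le_of_surjective g.rangeRestrict g.rangeRestrict_surjective)
  have : FaithfulSMul k g.range := by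
    rw [faithfulSMul_iff_algebraMap_injective]
    intro x y h
    exact FaithfulSMul.algebraMap_injective k R (congrArg Subtype.val h)
  obtain ⟨s, hs⟩ := exists_isTranscendenceBasis k g.range
  have halg := hs.isAlgebraic
  rw [Subtype.range_coe] at halg
  have hB : IsDomain B := (FaithfulSMul.algebraMap_injective B R).isDomain
  let s' : Set R := Subtype.val '' s
  let f₀ : Algebra.adjoin k s →+* R := g.range.val.toRingHom.comp (algebraMap _ _)
  have hf₀ : ∀ x, f₀ x ∈ (Algebra.adjoin B s').toSubring := by
    have hle : Algebra.adjoin k s ≤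
        ((Algebra.adjoin B s').restrictScalars k).comap g.range.val :=
      Algebra.adjoin_le fun x hx ↦ Algebra.subset_adjoin ⟨x, hx, rfl⟩
    exact fun x ↦ hle x.2
  let f : Algebra.adjoin k s →+* Algebra.adjoin B s' := f₀.codRestrict _ hf₀
  have hfi : Function.Injective f := fun x y h ↦ by
    have h1 : f₀ x = f₀ y := congrArg (Subtype.val : Algebra.adjoin B s' → R) h
    exact Subtype.ext (Subtype.ext h1)
  have hd : Algebra.IsAlgebraic (Algebra.adjoin B s') R := by
    refine ⟨fun y ↦ ?_⟩
    have hle : Algebra.adjoin B (Set.range g) ≤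
        (Subalgebra.algebraicClosure (Algebra.adjoin B s') R).restrictScalars B := by
      refine Algebra.adjoin_le ?_
      rintro _ ⟨a, rfl⟩
      exact (halg.isAlgebraic (g.rangeRestrict a)).ringHom_of_comp_eq f g.range.val.toRingHom hfi rfl
    exact hle (hg ▸ Algebra.mem_top)
  rw [← hs.enatCard_eq_eTrdeg, eTrdeg_eq_toENat_trdeg]
  refine le_trans (OrderHomClass.mono Cardinal.toENat
    (Algebra.IsAlgebraic.trdeg_le_cardinalMk B s')) ?_
  exact OrderHomClass.mono Cardinal.toENat Cardinal.mk_image_le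

/-- A localization-like extension of domains does not increase the transcendence degree. -/
theorem eTrdeg_le_of_forall_exists_mul [IsDomain k] [IsDomain R] [IsDomain S] [FaithfulSMul k S]
    (f : R →ₐ[k] S) (hf : ∀ s : S, ∃ a b : R, f a ≠ 0 ∧ f a * s = f b) :
    eTrdeg k S ≤ eTrdeg k R := by
  refine le_trans ?_ (eTrdeg_le_of_surjective f.rangeRestrict f.rangeRestrict_surjective)
  have : FaithfulSMul k f.range := by
    rw [faithfulSMul_iff_algebraMap_injective]
    intro x y h
    exact FaithfulSMul.algebraMap_injective k S (congrArg Subtype.val h)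
  have : Algebra.IsAlgebraic f.range S := by
    refine ⟨fun s ↦ ?_⟩
    obtain ⟨a, b, ha, hab⟩ := hf s
    refine ⟨.C (f.rangeRestrict a) * .X - .C (f.rangeRestrict b), fun h0 ↦ ha ?_, ?_⟩
    · have := congrArg (fun p ↦ Polynomial.coeff p 1) h0
      simpa [Polynomial.coeff_C] using congrArg Subtype.val this
    · simp [hab]
  rw [← eTrdeg_add_eq k f.range S, eTrdeg_eq_zero (k := f.range), add_zero]

end Trdeg

section ResidueTrdeg

variable {k R S : Type} [Field k] [CommRing R] [CommRing S] [Algebra k R] [Algebra k S]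

/-- Transcendence degree over `k` of the residue ring at an ideal. -/
def resTrdeg (k : Type) {R : Type} [Field k] [CommRing R] [Algebra k R] (P : Ideal R) : ℕ∞ :=
  eTrdeg k (R ⧸ P)

theorem resTrdeg_ker_le (f : R →ₐ[k] S) : resTrdeg k (RingHom.ker f) ≤ eTrdeg k S :=
  eTrdeg_le_of_injective (Ideal.kerLiftAlg f) (Ideal.kerLiftAlg_injective f)

theorem resTrdeg_bot : resTrdeg k (⊥ : Ideal R) = eTrdeg k R :=
  (AlgEquiv.quotientBot k R).eTrdeg_eq

theorem resTrdeg_comap_le (f : R →ₐ[k] S) (Q : Ideal S) :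
    resTrdeg k (Q.comap f) ≤ resTrdeg k Q :=
  eTrdeg_le_of_injective (Ideal.quotientMapₐ Q f le_rfl) Ideal.quotientMap_injective

theorem resTrdeg_comap_of_surjective (f : R →ₐ[k] S) (hf : Function.Surjective f) (Q : Ideal S) :
    resTrdeg k (Q.comap f) = resTrdeg k Q :=
  (resTrdeg_comap_le f Q).antisymm <|
    eTrdeg_le_of_surjective (Ideal.quotientMapₐ Q f le_rfl) (Ideal.quotientMap_surjective (H := le_rfl) hf)

theorem resTrdeg_ker_of_surjective (f : R →ₐ[k] S) (hf : Function.Surjective f) :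
    resTrdeg k (RingHom.ker f) = eTrdeg k S :=
  (Ideal.quotientKerAlgEquivOfSurjective hf).eTrdeg_eq

theorem resTrdeg_le_of_le {P Q : Ideal R} (h : P ≤ Q) : resTrdeg k Q ≤ resTrdeg k P :=
  eTrdeg_le_of_surjective (Ideal.Quotient.factorₐ k h) (Ideal.Quotient.factor_surjective h)

theorem resTrdeg_le_eTrdeg (P : Ideal R) : resTrdeg k P ≤ eTrdeg k R :=
  eTrdeg_le_of_surjective (Ideal.Quotient.mkₐ k P) (Ideal.Quotient.mkₐ_surjective k P)

theorem resTrdeg_add_one_le {P Q : Ideal R} [P.IsPrime] [Q.IsPrime] (h : P < Q) :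
    resTrdeg k Q + 1 ≤ resTrdeg k P := by
  refine eTrdeg_add_one_le (Ideal.Quotient.factorₐ k h.le) (Ideal.Quotient.factor_surjective h.le) ?_
  intro hi
  obtain ⟨x, hxQ, hxP⟩ := SetLike.exists_of_lt h
  refine hxP (Ideal.Quotient.eq_zero_iff_mem.1 (hi ?_))
  rw [map_zero]
  exact Ideal.Quotient.eq_zero_iff_mem.2 hxQ

/-- The residue transcendence degree at a prime of an algebra generated by the images of two
algebras is at most the sum of the ones at the contractions. -/
theorem resTrdeg_le_add {B A : Type} [CommRing A] [CommRing B] [Algebra k A] [Algebra k B]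
    (f : B →ₐ[k] S) (g : A →ₐ[k] S) (h : f.range ⊔ g.range = ⊤) (P : Ideal S) [P.IsPrime] :
    resTrdeg k P ≤ resTrdeg k (P.comap f) + resTrdeg k (P.comap g) := by
  let π : S →ₐ[k] S ⧸ P := Ideal.Quotient.mkₐ k P
  let B' := (π.comp f).range
  have h1 : eTrdeg k B' ≤ resTrdeg k (P.comap f) := by
    let f' := Ideal.quotientMapₐ P f le_rfl
    have : B' = f'.range := by
      ext x
      constructor
      · rintro ⟨b, rfl⟩
        exact ⟨Ideal.Quotient.mk _ b, rfl⟩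
      · rintro ⟨b, rfl⟩
        obtain ⟨b, rfl⟩ := Ideal.Quotient.mk_surjective b
        exact ⟨b, rfl⟩
    rw [this]
    exact eTrdeg_le_of_surjective f'.rangeRestrict f'.rangeRestrict_surjective
  have h2 : eTrdeg B' (S ⧸ P) ≤ resTrdeg k (P.comap g) := by
    refine eTrdeg_le_of_adjoin_range_eq_top (Ideal.quotientMapₐ P g le_rfl) ?_
    rw [eq_top_iff]
    rintro x -
    obtain ⟨x, rfl⟩ := Ideal.Quotient.mk_surjective x
    set W := (Algebra.adjoin B' (Set.range (Ideal.quotientMapₐ P g le_rfl))).restrictScalars k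
    have hle : f.range ⊔ g.range ≤ W.comap π := by
      refine sup_le ?_ ?_
      · rintro _ ⟨b, rfl⟩
        exact Subalgebra.algebraMap_mem (Algebra.adjoin B' _) (⟨π (f b), b, rfl⟩ : B')
      · rintro _ ⟨a, rfl⟩
        exact Algebra.subset_adjoin ⟨Ideal.Quotient.mk _ a, rfl⟩
    exact hle (h ▸ Algebra.mem_top)
  have : FaithfulSMul k B' :=
    (faithfulSMul_iff_algebraMap_injective k B').2 (algebraMap k B').injective
  rw [resTrdeg, ← eTrdeg_add_eq k B' (S ⧸ P)]
  exact add_le_add h1 h2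

theorem eTrdeg_polynomial_eq (A : Type) [CommRing A] [IsDomain A] [Algebra k A] :
    eTrdeg k (Polynomial A) = eTrdeg k A + 1 := by
  rw [← eTrdeg_add_eq k A (Polynomial A)]
  congr 1
  rw [eTrdeg_eq_toENat_trdeg, Polynomial.trdeg_of_isDomain, map_one]

theorem eTrdeg_mvPolynomial_eq (A : Type) [CommRing A] [IsDomain A] [Algebra k A] (n : ℕ) :
    eTrdeg k (MvPolynomial (Fin n) A) = eTrdeg k A + n := by
  rw [← eTrdeg_add_eq k A (MvPolynomial (Fin n) A), eTrdeg_mvPolynomial]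
  simp

theorem resTrdeg_map_polynomial_C (q : Ideal R) [q.IsPrime] :
    resTrdeg k (q.map (Polynomial.C : R →+* Polynomial R)) = resTrdeg k q + 1 := by
  have h := resTrdeg_ker_of_surjective (Polynomial.mapAlgHom (Ideal.Quotient.mkₐ k q))
    (Polynomial.map_surjective _ (Ideal.Quotient.mkₐ_surjective k q))
  have hk : RingHom.ker (Polynomial.mapAlgHom (Ideal.Quotient.mkₐ k q)) =
      q.map (Polynomial.C : R →+* Polynomial R) := by
    rw [← Ideal.mk_ker (I := q), ← Polynomial.ker_mapRingHom, Ideal.mk_ker]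
    rfl
  rw [← hk, h, eTrdeg_polynomial_eq, resTrdeg]

theorem ker_mvPolynomial_map_mk (n : ℕ) (q : Ideal R) :
    RingHom.ker (MvPolynomial.map (Ideal.Quotient.mk q) :
      MvPolynomial (Fin n) R →+* MvPolynomial (Fin n) (R ⧸ q)) = polyExt n q := by
  rw [MvPolynomial.ker_map, Ideal.mk_ker, polyExt]

instance polyExt.isPrime (n : ℕ) (q : Ideal R) [q.IsPrime] : (polyExt n q).IsPrime := by
  rw [← ker_mvPolynomial_map_mk]
  exact RingHom.ker_isPrime _

theorem resTrdeg_polyExt (n : ℕ) (q : Ideal R) [q.IsPrime] :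
    resTrdeg k (polyExt n q) = resTrdeg k q + n := by
  have h := resTrdeg_ker_of_surjective (MvPolynomial.mapAlgHom (σ := Fin n) (Ideal.Quotient.mkₐ k q))
    (MvPolynomial.map_surjective _ (Ideal.Quotient.mkₐ_surjective k q))
  rw [← ker_mvPolynomial_map_mk, resTrdeg.eq_def k q, ← eTrdeg_mvPolynomial_eq, ← h]
  rfl

theorem comap_C_polyExt (n : ℕ) (q : Ideal R) :
    (polyExt n q).comap (MvPolynomial.C : R →+* MvPolynomial (Fin n) R) = q := by
  rw [← ker_mvPolynomial_map_mk]
  ext x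
  simp [RingHom.mem_ker, Ideal.Quotient.eq_zero_iff_mem]

theorem polyExt_mono (n : ℕ) {p q : Ideal R} (h : p ≤ q) : polyExt n p ≤ polyExt n q :=
  Ideal.map_mono h

theorem polyExt_lt (n : ℕ) {p q : Ideal R} (h : p < q) : polyExt n p < polyExt n q := by
  refine lt_of_le_of_ne (polyExt_mono n h.le) fun h' ↦ h.ne ?_
  rw [← comap_C_polyExt n p, h', comap_C_polyExt]

theorem polyExt_le_iff (n : ℕ) {q : Ideal R} {N : Ideal (MvPolynomial (Fin n) R)} :
    polyExt n q ≤ N ↔ q ≤ N.comap (MvPolynomial.C : R →+* MvPolynomial (Fin n) R) :=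
  Ideal.map_le_iff_le_comap

end ResidueTrdeg

section Height

variable {k R S : Type} [Field k] [CommRing R] [CommRing S] [Algebra k R] [Algebra k S]

theorem exists_lt_of_add_one_le_height {P : Ideal R} [P.IsPrime] {n : ℕ}
    (h : ((n + 1 : ℕ) : ℕ∞) ≤ P.height) : ∃ P' : Ideal R, P'.IsPrime ∧ P' < P ∧ n ≤ P'.height := by
  by_contra! h'
  have := Ideal.height_le_iff.2 h'
  have := h.trans this
  norm_cast at this
  omega

theorem height_add_resTrdeg_le {N : ℕ∞} (h : ∀ P : Ideal R, P.IsPrime → resTrdeg k P ≤ N)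
    (P : Ideal R) [hP : P.IsPrime] : P.height + resTrdeg k P ≤ N := by
  have key : ∀ (n : ℕ) (P : Ideal R), P.IsPrime → n ≤ P.height → n + resTrdeg k P ≤ N := by
    intro n
    induction n with
    | zero => intro P hP _; simpa using h P hP
    | succ n ih =>
      intro P hP hn
      obtain ⟨P', hP', hlt, hn'⟩ := exists_lt_of_add_one_le_height hn
      refine le_trans ?_ (ih P' hP' hn')
      have := resTrdeg_add_one_le (k := k) hlt
      push_cast
      rw [add_assoc, add_comm 1]
      gcongr
  by_cases hN : N = ⊤
  · simp [hN]
  by_cases hf : P.height = ⊤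
  · lift N to ℕ using hN
    have := key (N + 1) P hP (by simp [hf])
    have := le_self_add.trans this
    norm_cast at this
    omega
  · lift P.height to ℕ using hf with n hn
    exact key n P hP hn.le

/-- A lower bound for the height of a contraction along a chain obtained by going down. -/
theorem height_comap_add_le_height_comap {A : Type} [CommRing A] [Algebra R S]
    [Algebra.HasGoingDown R S] (f : A →+* S) (P : Ideal S) [hP : P.IsPrime] {c : ℕ∞}
    (hs : ∀ Q₁ Q₂ : Ideal S, Q₁.IsPrime → Q₂.IsPrime → Q₁ < Q₂ → Q₂ ≤ P →
      Q₁.comap (algebraMap R S) < Q₂.comap (algebraMap R S) → Q₁.comap f < Q₂.comap f)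
    (hc : ∀ Q : Ideal S, Q.IsPrime → Q ≤ P → (Q.comap (algebraMap R S)).height = 0 →
      c ≤ (Q.comap f).height) :
    (P.comap (algebraMap R S)).height + c ≤ (P.comap f).height := by
  have key : ∀ (n : ℕ) (Q : Ideal S), Q.IsPrime → Q ≤ P →
      n ≤ (Q.comap (algebraMap R S)).height → n + c ≤ (Q.comap f).height := by
    intro n
    induction n with
    | zero =>
      intro Q hQ hQP _
      obtain ⟨m, hm, hmQ⟩ := Ideal.exists_minimalPrimes_le (bot_le : ⊥ ≤ Q.comap (algebraMap R S))
      have := hm.1.1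
      have : Q.LiesOver (Q.comap (algebraMap R S)) := ⟨rfl⟩
      obtain ⟨Q', hQ'Q, hQ', ⟨hover⟩⟩ := Ideal.exists_ideal_le_liesOver_of_le Q hmQ
      have h0 : (Q'.comap (algebraMap R S)).height = 0 := by
        rw [Ideal.under] at hover
        rw [← hover, Ideal.height_eq_zero_iff]
        exact hm
      simpa using (hc Q' hQ' (hQ'Q.trans hQP) h0).trans (Ideal.height_mono (Ideal.comap_mono hQ'Q))
    | succ n ih =>
      intro Q hQ hQP hn
      obtain ⟨p', hp', hlt, hn'⟩ := exists_lt_of_add_one_le_height hn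
      have : Q.LiesOver (Q.comap (algebraMap R S)) := ⟨rfl⟩
      obtain ⟨Q', hQ'Q, hQ', ⟨hover⟩⟩ := Ideal.exists_ideal_lt_liesOver_of_lt Q hlt
      rw [Ideal.under] at hover
      rw [hover] at hn' hlt
      have h1 := ih Q' hQ' (hQ'Q.le.trans hQP) hn'
      have h2 := Ideal.height_add_one_le_of_lt_of_isPrime (hs Q' Q hQ' hQ hQ'Q hQP hlt)
      refine le_trans ?_ h2
      push_cast
      rw [add_right_comm]
      gcongr
  by_cases hf : (P.comap (algebraMap R S)).height = ⊤
  · rw [hf, top_add, top_le_iff]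
    refine ENat.eq_top_iff_forall_ge.2 fun n ↦ le_self_add.trans (key n P hP le_rfl (by simp [hf]))
  · lift (P.comap (algebraMap R S)).height to ℕ using hf with n hn
    exact key n P hP le_rfl hn.le

end Height

section PolynomialHeight

variable {k B R : Type} [Field k] [CommRing B] [CommRing R] [Algebra k B] [Algebra k R]

/-- The isomorphism `B[X₀, …, Xₙ] ≃ B[X][X₁, …, Xₙ]`. -/
def finSuccEquivRight (k B : Type) [Field k] [CommRing B] [Algebra k B] (n : ℕ) :
    MvPolynomial (Fin (n + 1)) B ≃ₐ[k] MvPolynomial (Fin n) (Polynomial B) :=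
  ((MvPolynomial.renameEquiv B (finSuccEquiv n)).trans
    (MvPolynomial.optionEquivRight B (Fin n))).restrictScalars k

theorem finSuccEquivRight_C (n : ℕ) (b : B) :
    finSuccEquivRight k B n (MvPolynomial.C b) = MvPolynomial.C (Polynomial.C b) := by
  simp [finSuccEquivRight]

theorem height_polyExt_succ (n : ℕ) (q : Ideal B) :
    (polyExt n (q.map (Polynomial.C : B →+* Polynomial B))).height = (polyExt (n + 1) q).height := by
  obtain ⟨e, he⟩ : ∃ e : MvPolynomial (Fin (n + 1)) B ≃+* MvPolynomial (Fin n) (Polynomial B),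
      ∀ b, e (MvPolynomial.C b) = MvPolynomial.C (Polynomial.C b) :=
    ⟨((MvPolynomial.renameEquiv B (finSuccEquiv n)).trans
      (MvPolynomial.optionEquivRight B (Fin n))).toRingEquiv, fun b ↦ by simp⟩
  have hr : (MvPolynomial.C.comp Polynomial.C : B →+* MvPolynomial (Fin n) (Polynomial B)) =
      (e : MvPolynomial (Fin (n + 1)) B →+* _).comp MvPolynomial.C :=
    RingHom.ext fun b ↦ (he b).symm
  have h : polyExt n (q.map (Polynomial.C : B →+* Polynomial B)) =
      (polyExt (n + 1) q).map (e : MvPolynomial (Fin (n + 1)) B →+* _) := by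
    unfold polyExt
    rw [Ideal.map_map, Ideal.map_map, hr]
  rw [h]
  exact RingEquiv.height_map e _

theorem height_polyExt_add_le (n : ℕ) (N : Ideal (MvPolynomial (Fin n) B)) [hN : N.IsPrime] :
    (polyExt n (N.comap (MvPolynomial.C : B →+* MvPolynomial (Fin n) B))).height + n +
      resTrdeg k (N.comap (MvPolynomial.C : B →+* MvPolynomial (Fin n) B)) ≤
      N.height + resTrdeg k N := by
  induction n generalizing B with
  | zero =>
    rw [Nat.cast_zero, add_zero]
    exact add_le_add (Ideal.height_mono ((polyExt_le_iff 0).2 le_rfl))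
      (resTrdeg_comap_le (IsScalarTower.toAlgHom k B (MvPolynomial (Fin 0) B)) N)
  | succ n ih =>
    let e := finSuccEquivRight k B n
    let N' := N.comap (e.symm : MvPolynomial (Fin n) (Polynomial B) →ₐ[k] _)
    have hN' : N'.height = N.height := RingEquiv.height_comap e.symm.toRingEquiv N
    have hN't : resTrdeg k N' = resTrdeg k N :=
      resTrdeg_comap_of_surjective _ e.symm.surjective N
    set q := N.comap (MvPolynomial.C : B →+* MvPolynomial (Fin (n + 1)) B) with hq
    let N₁ := N'.comap (MvPolynomial.C : Polynomial B →+* MvPolynomial (Fin n) (Polynomial B))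
    have hqN₁ : N₁.comap (Polynomial.C : B →+* Polynomial B) = q := by
      ext b
      simp only [N₁, N', hq, Ideal.mem_comap]
      rw [← finSuccEquivRight_C (k := k)]
      simp [e]
    have h1 := ih (B := Polynomial B) N'
    rw [hN', hN't] at h1
    refine le_trans ?_ h1
    change _ ≤ (polyExt n N₁).height + n + resTrdeg k N₁
    rw [← height_polyExt_succ]
    have hle : q.map (Polynomial.C : B →+* Polynomial B) ≤ N₁ := by
      rw [Ideal.map_le_iff_le_comap, hqN₁]
    rcases hle.eq_or_lt with heq | hlt
    · rw [← heq, resTrdeg_map_polynomial_C]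
      push_cast
      apply le_of_eq
      ring
    · have h2 := Ideal.height_add_one_le_of_lt_of_isPrime (polyExt_lt n hlt)
      have h3 : resTrdeg k q ≤ resTrdeg k N₁ :=
        hqN₁ ▸ resTrdeg_comap_le (IsScalarTower.toAlgHom k B (Polynomial B)) N₁
      calc _ = ((polyExt n (q.map (Polynomial.C : B →+* Polynomial B))).height + 1) + n +
            resTrdeg k q := by push_cast; ring
        _ ≤ _ := by gcongr

theorem resTrdeg_add_height_polyExt_aux {t : ℕ} (f : B →ₐ[k] R) {Q' Q : Ideal R} [hQ' : Q'.IsPrime]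
    [hQ : Q.IsPrime] (hlt : Q' < Q) (hfin : resTrdeg k Q ≠ ⊤)
    (ht : resTrdeg k Q = resTrdeg k (Q.comap f) + t) :
    resTrdeg k (Q'.comap f) + (polyExt t (Q'.comap f)).height + resTrdeg k Q + 1 ≤
      resTrdeg k (Q.comap f) + (polyExt t (Q.comap f)).height + resTrdeg k Q' := by
  by_cases hqq : Q'.comap f = Q.comap f
  · rw [hqq]
    have := resTrdeg_add_one_le (k := k) hlt
    rw [add_assoc _ _ 1]
    gcongr
  let f' := Ideal.quotientMapₐ Q f le_rfl
  algebraize [f'.toRingHom]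
  have : IsScalarTower k (B ⧸ Q.comap f) (R ⧸ Q) := .of_algebraMap_eq' f'.comp_algebraMap.symm
  have : FaithfulSMul (B ⧸ Q.comap f) (R ⧸ Q) :=
    (faithfulSMul_iff_algebraMap_injective _ _).2 Ideal.quotientMap_injective
  have htd : eTrdeg (B ⧸ Q.comap f) (R ⧸ Q) = t := by
    have h1 := eTrdeg_add_eq k (B ⧸ Q.comap f) (R ⧸ Q)
    have h2 : resTrdeg k (Q.comap f) ≠ ⊤ := fun h ↦ hfin (by rw [ht, h, top_add])
    rw [← resTrdeg.eq_def, ← resTrdeg.eq_def, ht] at h1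
    exact ENat.add_right_injective_of_ne_top h2 h1
  obtain ⟨y', hy'⟩ := exists_algebraicIndependent_of_eTrdeg_eq htd
  choose y hy using fun i ↦ Ideal.Quotient.mk_surjective (y' i)
  let h : MvPolynomial (Fin t) B →ₐ[k] R := MvPolynomial.aevalTower f y
  have hC (P : Ideal R) :
      (P.comap h).comap (MvPolynomial.C : B →+* MvPolynomial (Fin t) B) = P.comap f := by
    ext b
    simp [h]
  have hN : Q.comap h = polyExt t (Q.comap f) := by
    refine le_antisymm (fun p hp ↦ ?_) ((polyExt_le_iff t).2 (hC Q).ge)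
    rw [← ker_mvPolynomial_map_mk, RingHom.mem_ker]
    refine hy'.1.eq_zero_of_aeval_eq_zero _ ?_
    have hcomp : ∀ p : MvPolynomial (Fin t) B, MvPolynomial.aeval y'
        (MvPolynomial.map (Ideal.Quotient.mk (Q.comap f)) p) = Ideal.Quotient.mk Q (h p) := by
      intro p
      induction p using MvPolynomial.induction_on with
      | C b => simp [h, RingHom.algebraMap_toAlgebra, f']
      | add p q hp hq => simp [hp, hq]
      | mul_X p i hp => simp [hp, h, hy]
    rw [hcomp, Ideal.Quotient.eq_zero_iff_mem]
    exact hp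
  have hltN : Q'.comap h < Q.comap h :=
    lt_of_le_of_ne (Ideal.comap_mono hlt.le) fun he ↦ hqq (by rw [← hC, he, hC])
  have h1 := Ideal.height_add_one_le_of_lt_of_isPrime hltN
  rw [hN] at h1
  have h2 := height_polyExt_add_le (k := k) t (Q'.comap h)
  rw [hC] at h2
  have h3 := resTrdeg_comap_le h Q'
  rw [ht]
  calc _ = (polyExt t (Q'.comap f)).height + t + resTrdeg k (Q'.comap f) +
        (resTrdeg k (Q.comap f) + 1) := by ring
    _ ≤ (Q'.comap h).height + resTrdeg k (Q'.comap h) + (resTrdeg k (Q.comap f) + 1) := by gcongr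
    _ = resTrdeg k (Q.comap f) + ((Q'.comap h).height + 1) + resTrdeg k (Q'.comap h) := by ring
    _ ≤ _ := by gcongr

/-- Comparison of the heights of the extensions to `B[X₁, …, X_t]` of the contractions to `B` of
two primes `Q' < Q` with the residue transcendence degrees. -/
theorem resTrdeg_add_height_polyExt_le {t w : ℕ} (f : B →ₐ[k] R) {Q' Q : Ideal R} [hQ' : Q'.IsPrime]
    [hQ : Q.IsPrime] (hlt : Q' < Q) (hfin : resTrdeg k Q ≠ ⊤)
    (hw : resTrdeg k Q = resTrdeg k (Q.comap f) + w) (hwt : w ≤ t) :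
    resTrdeg k (Q'.comap f) + (polyExt t (Q'.comap f)).height + resTrdeg k Q + 1 ≤
      resTrdeg k (Q.comap f) + (polyExt t (Q.comap f)).height + resTrdeg k Q' := by
  obtain ⟨s, rfl⟩ := Nat.exists_eq_add_of_le hwt
  let f' : B →ₐ[k] MvPolynomial (Fin s) R := (IsScalarTower.toAlgHom k R _).comp f
  have hf' (P : Ideal R) : (polyExt s P).comap f' = P.comap f :=
    congrArg (Ideal.comap f) (comap_C_polyExt s P)
  have h := resTrdeg_add_height_polyExt_aux (t := w + s) f' (polyExt_lt s hlt)
  simp only [hf', resTrdeg_polyExt, hw] at h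
  have h := h (by simpa [← hw] using hfin) (by push_cast; ring)
  rw [hw]
  refine (ENat.add_le_add_iff_right (ENat.natCast_ne_top s)).1 (le_trans (le_of_eq ?_) (h.trans (le_of_eq ?_))) <;> ring

end PolynomialHeight

section Tensor

variable {k : Type} [Field k]

theorem range_includeLeft_sup_range_includeRight (k A B : Type) [CommRing k] [CommRing A]
    [CommRing B] [Algebra k A] [Algebra k B] :
    (Algebra.TensorProduct.includeLeft : A →ₐ[k] A ⊗[k] B).range ⊔
      (Algebra.TensorProduct.includeRight : B →ₐ[k] A ⊗[k] B).range = ⊤ := by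
  refine eq_top_iff.2 fun z _ ↦ ?_
  induction z with
  | zero => exact zero_mem _
  | add x y hx hy => exact add_mem (hx trivial) (hy trivial)
  | tmul a b =>
    have h := mul_mem
      (Algebra.mem_sup_left (T := (Algebra.TensorProduct.includeRight : B →ₐ[k] A ⊗[k] B).range)
        ((Algebra.TensorProduct.includeLeft : A →ₐ[k] A ⊗[k] B).mem_range_self a))
      (Algebra.mem_sup_right ((Algebra.TensorProduct.includeRight : B →ₐ[k] A ⊗[k] B).mem_range_self b))
    simpa using h

theorem resTrdeg_tensor_le {A B : Type} [CommRing A] [CommRing B] [Algebra k A] [Algebra k B]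
    (P : Ideal (A ⊗[k] B)) [P.IsPrime] :
    resTrdeg k P ≤ resTrdeg k (P.comap (Algebra.TensorProduct.includeLeft : A →ₐ[k] A ⊗[k] B)) +
      resTrdeg k (P.comap (Algebra.TensorProduct.includeRight : B →ₐ[k] A ⊗[k] B)) :=
  resTrdeg_le_add _ _ (range_includeLeft_sup_range_includeRight k A B) P

theorem height_polyExt_ne_top {B : Type} [CommRing B] [Algebra k B] (hB : eTrdeg k B ≠ ⊤) (t : ℕ)
    (q : Ideal B) [q.IsPrime] : (polyExt t q).height ≠ ⊤ := by
  have h := height_add_resTrdeg_le (k := k) (N := eTrdeg k B + t) (fun P hP ↦ by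
    have h1 := resTrdeg_le_add (IsScalarTower.toAlgHom k B (MvPolynomial (Fin t) B))
      (MvPolynomial.aeval (R := k) (MvPolynomial.X : Fin t → MvPolynomial (Fin t) B))
      (by
        refine eq_top_iff.2 fun p _ ↦ ?_
        induction p using MvPolynomial.induction_on with
        | C b => exact Algebra.mem_sup_left ⟨b, rfl⟩
        | add p q hp hq => exact add_mem (hp trivial) (hq trivial)
        | mul_X p i hp => exact mul_mem (hp trivial) (Algebra.mem_sup_right ⟨.X i, by simp⟩)) P
    have h2 := resTrdeg_le_eTrdeg (k := k) (P.comap (MvPolynomial.aeval (R := k)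
      (MvPolynomial.X : Fin t → MvPolynomial (Fin t) B)))
    rw [eTrdeg_mvPolynomial_eq, eTrdeg_eq_zero, zero_add] at h2
    exact h1.trans (add_le_add (resTrdeg_le_eTrdeg _) h2)) (polyExt t q)
  intro htop
  rw [htop, top_add, top_le_iff] at h
  exact (WithTop.add_ne_top.2 ⟨hB, ENat.natCast_ne_top t⟩) h

theorem Ideal.comap_lt_comap_of_forall_exists_mul {R S : Type} [CommRing R] [CommRing S] (f : R →+* S)
    {Q₁ Q₂ : Ideal S} [Q₁.IsPrime] (hlt : Q₁ < Q₂)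
    (hf : ∀ z, ∃ m y, f m ∉ Q₁ ∧ f m * z = f y) : Q₁.comap f < Q₂.comap f := by
  refine lt_of_le_not_ge (Ideal.comap_mono hlt.le) fun hle ↦ ?_
  obtain ⟨z, hz₂, hz₁⟩ := SetLike.exists_of_lt hlt
  obtain ⟨m, y, hm, hmy⟩ := hf z
  have hy : f y ∈ Q₁ := hle (show f y ∈ Q₂ from hmy ▸ Q₂.mul_mem_left _ hz₂)
  rw [← hmy] at hy
  exact (Ideal.IsPrime.mem_or_mem inferInstance hy).elim hm hz₁

theorem resTrdeg_le_resTrdeg_comap {R S : Type} [CommRing R] [CommRing S] [Algebra k R]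
    [Algebra k S] (f : R →ₐ[k] S) (Q : Ideal S) [Q.IsPrime]
    (hf : ∀ z, ∃ m y, f m ∉ Q ∧ f m * z = f y) : resTrdeg k Q ≤ resTrdeg k (Q.comap f) := by
  refine eTrdeg_le_of_forall_exists_mul (Ideal.quotientMapₐ Q f le_rfl) fun s ↦ ?_
  obtain ⟨z, rfl⟩ := Ideal.Quotient.mk_surjective s
  obtain ⟨m, y, hm, hmy⟩ := hf z
  refine ⟨Ideal.Quotient.mk _ m, Ideal.Quotient.mk _ y, ?_, ?_⟩
  · simpa [Ideal.Quotient.eq_zero_iff_mem] using hm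
  · have := congrArg (Ideal.Quotient.mk Q) hmy
    simpa using this

theorem exists_mul_eq_map_tensorProduct {A T B : Type} [CommRing A] [CommRing T] [CommRing B]
    [Algebra k A] [Algebra k T] [Algebra k B] (u : A →ₐ[k] T) (W : Submonoid A)
    (hu : ∀ x, ∃ m ∈ W, ∃ y, u m * x = u y) (z : T ⊗[k] B) :
    ∃ m ∈ W, ∃ y : A ⊗[k] B, (u m ⊗ₜ 1) * z =
      Algebra.TensorProduct.map u (AlgHom.id k B) y := by
  induction z with
  | zero => exact ⟨1, one_mem _, 0, by simp⟩
  | tmul x b =>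
    obtain ⟨m, hm, y, h⟩ := hu x
    exact ⟨m, hm, y ⊗ₜ b, by simp [h]⟩
  | add z₁ z₂ h₁ h₂ =>
    obtain ⟨m₁, hm₁, y₁, h₁⟩ := h₁
    obtain ⟨m₂, hm₂, y₂, h₂⟩ := h₂
    refine ⟨m₁ * m₂, mul_mem hm₁ hm₂, (m₂ ⊗ₜ 1) * y₁ + (m₁ ⊗ₜ 1) * y₂, ?_⟩
    simp only [map_add, map_mul, ← h₁, ← h₂]
    simp only [Algebra.TensorProduct.map_tmul, AlgHom.id_apply]
    rw [show (u m₁ * u m₂) ⊗ₜ[k] (1 : B) = (u m₁ ⊗ₜ 1) * (u m₂ ⊗ₜ 1) by simp]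
    ring

/-- An upper bound for the height of a prime in terms of its contraction along `f : B → S`, when
residue transcendence degrees grow by at most `t` along `f`. -/
theorem height_add_resTrdeg_le_of_forall {B S : Type} [CommRing B] [CommRing S] [Algebra k B]
    [Algebra k S] (f : B →ₐ[k] S) (t : ℕ) (hB : eTrdeg k B ≠ ⊤)
    (hf : ∀ P : Ideal S, P.IsPrime → resTrdeg k P ≤ resTrdeg k (P.comap f) + t)
    (P : Ideal S) [hP : P.IsPrime] :
    P.height + resTrdeg k P ≤ t + resTrdeg k (P.comap f) + (polyExt t (P.comap f)).height := by
  have hq (q : Ideal B) : resTrdeg k q ≠ ⊤ := ne_top_of_le_ne_top hB (resTrdeg_le_eTrdeg q)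
  have htd (P : Ideal S) [P.IsPrime] : resTrdeg k P ≠ ⊤ :=
    ne_top_of_le_ne_top (WithTop.add_ne_top.2 ⟨hq _, ENat.natCast_ne_top t⟩) (hf P ‹_›)
  have hH (q : Ideal B) [q.IsPrime] := height_polyExt_ne_top hB t q
  have key (n : ℕ) : ∀ (P : Ideal S) [P.IsPrime], (n : ℕ∞) ≤ P.height →
      n + resTrdeg k P ≤ t + resTrdeg k (P.comap f) + (polyExt t (P.comap f)).height := by
    induction n with
    | zero =>
      intro P _ _
      rw [Nat.cast_zero, zero_add, add_comm (t : ℕ∞)]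
      exact (hf P ‹_›).trans le_self_add
    | succ n ih =>
      intro P _ hn
      obtain ⟨P', hP', hlt, hn'⟩ := exists_lt_of_add_one_le_height hn
      have h1 := ih P' hn'
      have h2 := hf P ‹_›
      have h3 := resTrdeg_comap_le f P
      have h4 := fun w ↦ resTrdeg_add_height_polyExt_le (t := t) (w := w) f hlt (htd P)
      have i1 := htd P
      have i2 := htd P'
      have i3 := hq (P.comap f)
      have i4 := hq (P'.comap f)
      have i5 := hH (P.comap f)
      have i6 := hH (P'.comap f)
      generalize resTrdeg k P = a at *
      generalize resTrdeg k P' = b at *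
      generalize resTrdeg k (P.comap f) = c at *
      generalize resTrdeg k (P'.comap f) = d at *
      generalize (polyExt t (P.comap f)).height = e at *
      generalize (polyExt t (P'.comap f)).height = g at *
      lift a to ℕ using i1
      lift b to ℕ using i2
      lift c to ℕ using i3
      lift d to ℕ using i4
      lift e to ℕ using i5
      lift g to ℕ using i6
      norm_cast at *
      have := h4 (a - c) (by omega) (by omega)
      omega
  have hfin : P.height ≠ ⊤ := by
    intro htop
    obtain ⟨N, hN⟩ := ENat.ne_top_iff_exists.1 (WithTop.add_ne_top.2
      ⟨WithTop.add_ne_top.2 ⟨ENat.natCast_ne_top t, hq (P.comap f)⟩, hH (P.comap f)⟩)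
    have h := le_self_add.trans (key (N + 1) P (htop ▸ le_top))
    erw [← hN] at h
    norm_cast at h
    omega
  obtain ⟨n, hn⟩ := ENat.ne_top_iff_exists.1 hfin
  rw [← hn]
  exact key n P hn.le

end Tensor

section FlatDescent

theorem height_comap_add_le_height_comap_of_flat {R S A : Type} [CommRing R] [CommRing S]
    [CommRing A] (g : R →+* S) (hg : g.Flat) (f : A →+* S) (P : Ideal S) [hP : P.IsPrime] {c : ℕ∞}
    (hs : ∀ Q₁ Q₂ : Ideal S, Q₁.IsPrime → Q₂.IsPrime → Q₁ < Q₂ → Q₂ ≤ P →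
      Q₁.comap g < Q₂.comap g → Q₁.comap f < Q₂.comap f)
    (hc : ∀ Q : Ideal S, Q.IsPrime → Q ≤ P → (Q.comap g).height = 0 → c ≤ (Q.comap f).height) :
    (P.comap g).height + c ≤ (P.comap f).height := by
  algebraize [g]
  exact height_comap_add_le_height_comap (R := R) f P hs hc

theorem Module.Flat.of_isDomain_of_field (R E : Type) [CommRing R] [IsDomain R] [Field E]
    [Algebra R E] [FaithfulSMul R E] : Module.Flat R E := by
  let _ := FractionRing.liftAlgebra R E
  have := FractionRing.isScalarTower_liftAlgebra R E
  have := IsLocalization.flat (FractionRing R) (nonZeroDivisors R)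
  exact Module.Flat.trans R (FractionRing R) E

variable {k : Type} [Field k]

theorem eTrdeg_fractionRing (R : Type) [CommRing R] [IsDomain R] [Algebra k R] :
    eTrdeg k (FractionRing R) = eTrdeg k R := by
  refine le_antisymm ?_ (eTrdeg_le_of_injective (IsScalarTower.toAlgHom k R (FractionRing R))
    (IsFractionRing.injective R _))
  refine eTrdeg_le_of_forall_exists_mul (IsScalarTower.toAlgHom k R (FractionRing R)) fun s ↦ ?_
  obtain ⟨a, b, hb, rfl⟩ := IsFractionRing.div_surjective (A := R) s
  have : algebraMap R (FractionRing R) b ≠ 0 := by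
    simpa using nonZeroDivisors.ne_zero hb
  exact ⟨b, a, this, by simp; field_simp⟩

theorem height_polyExt_add_le_of_comap_includeLeft_eq_bot {C B : Type} [CommRing C] [IsDomain C]
    [CommRing B] [Algebra k C] [Algebra k B] {t : ℕ} (ht : eTrdeg k C = t) (P : Ideal (C ⊗[k] B))
    [hP : P.IsPrime] (hPC : P.comap (Algebra.TensorProduct.includeLeft : C →ₐ[k] C ⊗[k] B) = ⊥) :
    (polyExt t (P.comap (Algebra.TensorProduct.includeRight : B →ₐ[k] C ⊗[k] B))).height + t +
      resTrdeg k (P.comap (Algebra.TensorProduct.includeRight : B →ₐ[k] C ⊗[k] B)) ≤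
      P.height + resTrdeg k P := by
  obtain ⟨x, hx⟩ := exists_algebraicIndependent_of_eTrdeg_eq ht
  let E := FractionRing C
  let ι : C →ₐ[k] E := IsScalarTower.toAlgHom k C E
  have hι : Function.Injective ι := IsFractionRing.injective C E
  let f : C ⊗[k] B →ₐ[k] E ⊗[k] B := Algebra.TensorProduct.map ι (AlgHom.id k B)
  let g' : MvPolynomial (Fin t) B →ₐ[k] C ⊗[k] B :=
    ((Algebra.TensorProduct.map (MvPolynomial.aeval x) (AlgHom.id k B)).comp
      (Algebra.TensorProduct.comm k B (MvPolynomial (Fin t) k)).toAlgHom).comp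
      ((MvPolynomial.algebraTensorAlgEquiv k B).symm.toAlgHom.restrictScalars k)
  have hflat : (f.comp g').toRingHom.Flat := by
    have h1 : ((ι.comp (MvPolynomial.aeval x)) : MvPolynomial (Fin t) k →ₐ[k] E).toRingHom.Flat := by
      algebraize [((ι.comp (MvPolynomial.aeval x)) : MvPolynomial (Fin t) k →ₐ[k] E).toRingHom]
      have : FaithfulSMul (MvPolynomial (Fin t) k) E :=
        (faithfulSMul_iff_algebraMap_injective _ _).2 (hι.comp hx.1)
      exact Module.Flat.of_isDomain_of_field _ _
    have h2 := RingHom.Flat.tensorProductMap (S := k) h1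
      (g := AlgHom.id k B) (RingHom.Flat.id B)
    have h3 : f.comp g' = ((Algebra.TensorProduct.map (ι.comp (MvPolynomial.aeval x))
      (AlgHom.id k B)).comp (Algebra.TensorProduct.comm k B (MvPolynomial (Fin t) k)).toAlgHom).comp
      ((MvPolynomial.algebraTensorAlgEquiv k B).symm.toAlgHom.restrictScalars k) := by
      have : f.comp (Algebra.TensorProduct.map (MvPolynomial.aeval x) (AlgHom.id k B)) =
        Algebra.TensorProduct.map (ι.comp (MvPolynomial.aeval x)) (AlgHom.id k B) := by
        ext <;> simp [f]
      rw [← this]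
      rfl
    rw [h3]
    exact (RingHom.Flat.of_bijective (MvPolynomial.algebraTensorAlgEquiv k B).symm.bijective).comp
      ((RingHom.Flat.of_bijective (Algebra.TensorProduct.comm k B _).bijective).comp h2)
  have hgC (I : Ideal (C ⊗[k] B)) :
      (I.comap g').comap (MvPolynomial.C : B →+* MvPolynomial (Fin t) B) =
      I.comap (Algebra.TensorProduct.includeRight : B →ₐ[k] C ⊗[k] B) := by
    ext b
    have : (MvPolynomial.algebraTensorAlgEquiv k B).symm (MvPolynomial.C (σ := Fin t) b) =
        b ⊗ₜ[k] 1 := by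
      rw [AlgEquiv.symm_apply_eq]
      simp [Algebra.smul_def, MvPolynomial.algebraMap_eq]
    simp [g', this]
  let L := FractionRing ((C ⊗[k] B) ⧸ P)
  let π : C ⊗[k] B →ₐ[k] L :=
    (IsScalarTower.toAlgHom k _ L).comp (Ideal.Quotient.mkₐ k P)
  have hπ (z) : π z = 0 ↔ z ∈ P := by
    simp [π, Ideal.Quotient.eq_zero_iff_mem]
  have hinj : Function.Injective (π.comp Algebra.TensorProduct.includeLeft) := by
    rw [injective_iff_map_eq_zero]
    intro c hc
    have : c ∈ P.comap (Algebra.TensorProduct.includeLeft : C →ₐ[k] C ⊗[k] B) := (hπ _).1 hc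
    simpa [hPC] using this
  let ψ : E ⊗[k] B →ₐ[k] L := Algebra.TensorProduct.productMap (IsFractionRing.liftAlgHom hinj)
    (π.comp Algebra.TensorProduct.includeRight)
  have hψ : ψ.comp f = π := by
    ext c
    · simp [ψ, f, ι, ← Algebra.TensorProduct.one_def]
    · simp [ψ, f]
  have hQf : (RingHom.ker ψ).comap f = P := by
    ext z
    rw [← hπ, ← hψ]
    rfl
  have hmain := height_comap_add_le_height_comap_of_flat (f.comp g').toRingHom hflat f.toRingHom
    (RingHom.ker ψ) (hP := RingHom.ker_isPrime ψ.toRingHom) (c := 0) (fun Q₁ Q₂ hQ₁ _ hlt _ _ ↦ by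
      refine Ideal.comap_lt_comap_of_forall_exists_mul _ hlt fun z ↦ ?_
      obtain ⟨m, hm, y, h⟩ := exists_mul_eq_map_tensorProduct (B := B) ι (nonZeroDivisors C)
        (fun e ↦ by
          obtain ⟨a, b, hb, rfl⟩ := IsFractionRing.div_surjective (A := C) e
          have : algebraMap C E b ≠ 0 := by simpa using nonZeroDivisors.ne_zero hb
          exact ⟨b, hb, a, mul_div_cancel₀ _ this⟩) z
      refine ⟨m ⊗ₜ 1, y, fun hmQ ↦ hQ₁.ne_top (Ideal.eq_top_of_isUnit_mem _ hmQ ?_), h⟩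
      have hu : IsUnit (ι m) := by
        exact IsUnit.mk0 _ (by simpa [ι] using nonZeroDivisors.ne_zero hm)
      simpa [f] using hu.map (Algebra.TensorProduct.includeLeft : E →ₐ[k] E ⊗[k] B))
      (fun _ _ _ _ ↦ zero_le)
  have hcomap : (RingHom.ker ψ).comap (f.comp g').toRingHom = P.comap g' := by
    conv_rhs => rw [← hQf]
    rfl
  rw [hcomap, add_zero] at hmain
  have hmain : (P.comap g').height ≤ P.height := by
    refine hmain.trans (le_of_eq ?_)
    exact congrArg Ideal.height hQf
  have h := height_polyExt_add_le (k := k) t (P.comap g')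
  rw [hgC] at h
  exact h.trans (add_le_add hmain (resTrdeg_comap_le g' P))

end FlatDescent

section LowerBound

theorem eTrdeg_add_le_of_range_sup_range_eq_top {k S L T Ω : Type} [Field k] [CommRing S]
    [IsDomain S] [Field L] [CommRing T] [IsDomain T] [CommRing Ω] [IsDomain Ω] [Algebra k S]
    [Algebra k L] [Algebra k T] [Algebra k Ω] [Algebra S L] [Algebra S T] [Algebra S Ω]
    [IsScalarTower k S L] [IsScalarTower k S T] [IsScalarTower k S Ω] [FaithfulSMul S L]
    [FaithfulSMul S T] (j : L →ₐ[S] Ω) (g : T →ₐ[S] Ω) (h : j.range ⊔ g.range = ⊤) :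
    eTrdeg k Ω + eTrdeg k S ≤ eTrdeg k L + eTrdeg k T := by
  algebraize [j.toRingHom]
  have : IsScalarTower S L Ω := .of_algebraMap_eq' j.comp_algebraMap.symm
  have : IsScalarTower k L Ω := .of_algebraMap_eq fun x ↦ by
    rw [IsScalarTower.algebraMap_apply k S Ω, IsScalarTower.algebraMap_apply k S L,
      ← IsScalarTower.algebraMap_apply S L Ω]
  have : FaithfulSMul L Ω := (faithfulSMul_iff_algebraMap_injective _ _).2 (RingHom.injective _)
  have : FaithfulSMul S Ω := FaithfulSMul.trans S L Ω
  have h1 : eTrdeg L Ω ≤ eTrdeg S T := by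
    refine eTrdeg_le_of_adjoin_range_eq_top g (eq_top_iff.2 fun x _ ↦ ?_)
    have hx : x ∈ j.range ⊔ g.range := h ▸ Algebra.mem_top
    have hle : j.range ⊔ g.range ≤ (Algebra.adjoin L (Set.range g)).restrictScalars S := by
      refine sup_le ?_ ?_
      · rintro _ ⟨l, rfl⟩
        change algebraMap L Ω l ∈ Algebra.adjoin L (Set.range g)
        exact Subalgebra.algebraMap_mem _ l
      · rintro _ ⟨y, rfl⟩
        change g y ∈ Algebra.adjoin L (Set.range g)
        exact Algebra.subset_adjoin (Set.mem_range_self y)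
    exact hle hx
  rw [← eTrdeg_add_eq k L Ω, ← eTrdeg_add_eq k S T, add_assoc, add_comm _ (eTrdeg k S)]
  gcongr

theorem resTrdeg_add_eTrdeg_le {k S L T : Type} [Field k] [CommRing S] [IsDomain S] [Field L]
    [CommRing T] [IsDomain T] [Algebra k S] [Algebra k L] [Algebra k T] [Algebra S L] [Algebra S T]
    [IsScalarTower k S L] [IsScalarTower k S T] [FaithfulSMul S L] [FaithfulSMul S T]
    (Q : Ideal (T ⊗[S] L)) [Q.IsPrime] :
    resTrdeg k Q + eTrdeg k S ≤ eTrdeg k L + eTrdeg k T := by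
  refine eTrdeg_add_le_of_range_sup_range_eq_top (Ω := (T ⊗[S] L) ⧸ Q)
    ((Ideal.Quotient.mkₐ S Q).comp Algebra.TensorProduct.includeRight)
    ((Ideal.Quotient.mkₐ S Q).comp Algebra.TensorProduct.includeLeft) ?_
  rw [AlgHom.range_comp, AlgHom.range_comp, ← Algebra.map_sup, sup_comm,
    range_includeLeft_sup_range_includeRight, Algebra.map_top, AlgHom.range_eq_top]
  exact Ideal.Quotient.mkₐ_surjective S Q

variable {k : Type} [Field k]

set_option maxHeartbeats 1000000 in
theorem le_height_comap_add_resTrdeg {A T B : Type} [CommRing A] [IsDomain A] [CommRing T] [IsDomain T]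
    [CommRing B] [Algebra k A] [Algebra k T] [Algebra k B] (u : A →ₐ[k] T)
    (hu : Function.Injective u) {t : ℕ} (hA : eTrdeg k A = t) (hT : eTrdeg k T = t)
    (hB : eTrdeg k B ≠ ⊤) (Q : Ideal (T ⊗[k] B)) [hQ : Q.IsPrime] {p : Ideal T}
    (hp : p = Q.comap (Algebra.TensorProduct.includeLeft : T →ₐ[k] T ⊗[k] B))
    (hpt : p.height + resTrdeg k p = t) {q : Ideal B}
    (hq : q = Q.comap (Algebra.TensorProduct.includeRight : B →ₐ[k] T ⊗[k] B))
    (hs : ∀ Q₁ Q₂ : Ideal (T ⊗[k] B), Q₁.IsPrime → Q₂.IsPrime → Q₁ < Q₂ →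
      Q₁.comap (Algebra.TensorProduct.includeLeft : T →ₐ[k] T ⊗[k] B) < p →
      Q₁.comap (Algebra.TensorProduct.map u (AlgHom.id k B)) <
        Q₂.comap (Algebra.TensorProduct.map u (AlgHom.id k B))) :
    (polyExt t q).height + t + resTrdeg k q ≤
      (Q.comap (Algebra.TensorProduct.map u (AlgHom.id k B))).height + resTrdeg k Q := by
  have hpP : p.IsPrime := hp ▸ Ideal.IsPrime.comap _
  have hqP : q.IsPrime := hq ▸ Ideal.IsPrime.comap _
  obtain ⟨s, hs'⟩ : ∃ s : ℕ, resTrdeg k p = s :=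
    ENat.ne_top_iff_exists.1 (ne_top_of_le_ne_top (ENat.natCast_ne_top t) (hpt ▸ le_add_self))
      |>.imp fun _ h ↦ h.symm
  have : FaithfulSMul k (T ⧸ p) :=
    (faithfulSMul_iff_algebraMap_injective _ _).2 (algebraMap k (T ⧸ p)).injective
  obtain ⟨y', hy'⟩ := exists_algebraicIndependent_of_eTrdeg_eq (R := T ⧸ p) hs'
  choose y hy using fun i ↦ Ideal.Quotient.mk_surjective (y' i)
  let S := MvPolynomial (Fin s) k
  let L := FractionRing ((T ⊗[k] B) ⧸ Q)
  let π : T ⊗[k] B →ₐ[k] L :=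
    (IsScalarTower.toAlgHom k _ L).comp (Ideal.Quotient.mkₐ k Q)
  have hπ (z) : π z = 0 ↔ z ∈ Q := by
    simp [π, Ideal.Quotient.eq_zero_iff_mem]
  let a : S →ₐ[k] T := MvPolynomial.aeval y
  let πT : T →ₐ[k] L := π.comp Algebra.TensorProduct.includeLeft
  have hπT (x) : πT x = 0 ↔ x ∈ p := by
    rw [hp]
    exact hπ _
  have haL : Function.Injective (πT.comp a) := by
    rw [injective_iff_map_eq_zero]
    intro c hc
    have h1 : a c ∈ p := (hπT _).1 hc
    refine hy'.1.eq_zero_of_aeval_eq_zero _ ?_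
    rw [← Ideal.Quotient.eq_zero_iff_mem] at h1
    rw [← h1, show y' = fun i ↦ Ideal.Quotient.mkₐ k p (y i) from funext fun i ↦ (hy i).symm,
      ← MvPolynomial.comp_aeval_apply]
    rfl
  have haT : Function.Injective a := fun c d h ↦ haL (congrArg πT h)
  algebraize [a.toRingHom, (πT.comp a).toRingHom]
  have : IsScalarTower k S T := .of_algebraMap_eq' a.comp_algebraMap.symm
  have : IsScalarTower k S L := .of_algebraMap_eq' (πT.comp a).comp_algebraMap.symm
  have : FaithfulSMul S T := (faithfulSMul_iff_algebraMap_injective _ _).2 haT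
  have : FaithfulSMul S L := (faithfulSMul_iff_algebraMap_injective _ _).2 haL
  have hSt : eTrdeg k S = s := by
    rw [eTrdeg_mvPolynomial]
    simp
  have hLt : eTrdeg k L = resTrdeg k Q := eTrdeg_fractionRing _
  have : Module.Flat S L := Module.Flat.of_isDomain_of_field S L
  let R' := T ⊗[S] L
  let ιT : T →ₐ[S] R' := Algebra.TensorProduct.includeLeft
  let ιL : L →ₐ[S] R' := Algebra.TensorProduct.includeRight
  have hflat : ιT.toRingHom.Flat := by
    have : Module.Flat T (T ⊗[S] L) := inferInstance
    exact RingHom.flat_algebraMap_iff.2 this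
  let πS : T →ₐ[S] L := { πT with commutes' := fun _ ↦ rfl }
  let ε : R' →ₐ[S] L := Algebra.TensorProduct.productMap πS (AlgHom.id S L)
  have hεT (x) : ε (ιT x) = πT x :=
    DFunLike.congr_fun (Algebra.TensorProduct.productMap_left πS (AlgHom.id S L)) x
  have hεL (x) : ε (ιL x) = x :=
    DFunLike.congr_fun (Algebra.TensorProduct.productMap_right πS (AlgHom.id S L)) x
  let πB : B →ₐ[k] L := π.comp Algebra.TensorProduct.includeRight
  let h : T ⊗[k] B →ₐ[k] R' := Algebra.TensorProduct.productMap (ιT.restrictScalars k)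
    ((ιL.restrictScalars k).comp πB)
  have hh : (ε.restrictScalars k).comp h = π := by
    ext x
    · simp [h, hεT, πT]
    · simp [h, hεL, πB]
  have hQh : (RingHom.ker ε).comap h = Q := by
    ext z
    rw [← hπ, ← hh]
    rfl
  have hQp : (RingHom.ker ε).comap ιT = p := by
    ext z
    rw [← hπT, ← hεT]
    rfl
  have hhT (I : Ideal R') : (I.comap h).comap
      (Algebra.TensorProduct.includeLeft : T →ₐ[k] T ⊗[k] B) = I.comap ιT := by
    ext x
    simp [h]
  have hhB (I : Ideal R') (hI : I.IsPrime) : (I.comap h).comap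
      (Algebra.TensorProduct.includeRight : B →ₐ[k] T ⊗[k] B) = q := by
    ext b
    have h1 : I.comap ιL = ⊥ := by
      have : (I.comap ιL).IsPrime := hI.comap _
      exact (Ideal.eq_bot_or_top _).resolve_right this.ne_top
    have h2 : πB b ∈ I.comap ιL ↔ b ∈ q := by
      rw [h1, hq]
      exact hπ _
    rw [← h2]
    simp [h]
  let F : A ⊗[k] B →ₐ[k] T ⊗[k] B := Algebra.TensorProduct.map u (AlgHom.id k B)
  have hFA (I : Ideal (T ⊗[k] B)) : (I.comap F).comap
      (Algebra.TensorProduct.includeLeft : A →ₐ[k] A ⊗[k] B) =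
      (I.comap (Algebra.TensorProduct.includeLeft : T →ₐ[k] T ⊗[k] B)).comap u := by
    ext x
    simp [F]
  have hFB (I : Ideal (T ⊗[k] B)) : (I.comap F).comap
      (Algebra.TensorProduct.includeRight : B →ₐ[k] A ⊗[k] B) =
      I.comap (Algebra.TensorProduct.includeRight : B →ₐ[k] T ⊗[k] B) := by
    ext x
    simp [F]
  have hgen (Q' : Ideal R') (hQ' : Q'.IsPrime) (h0 : (Q'.comap ιT).height = 0) :
      (polyExt t q).height + t + resTrdeg k q + s ≤
        ((Q'.comap h).comap F).height + resTrdeg k Q + t := by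
    have hbot : Q'.comap ιT = ⊥ := by
      have : (Q'.comap ιT).IsPrime := Ideal.IsPrime.comap _
      by_contra hne
      have := Ideal.height_add_one_le_of_lt_of_isPrime (bot_lt_iff_ne_bot.2 hne)
      rw [h0] at this
      simp at this
    have h1 := height_polyExt_add_le_of_comap_includeLeft_eq_bot hA ((Q'.comap h).comap F) (by
      rw [hFA, hhT, hbot]
      exact (RingHom.ker_eq_comap_bot _).symm.trans ((RingHom.injective_iff_ker_eq_bot _).1 hu))
    rw [hFB, hhB Q' hQ'] at h1
    have h2 := (resTrdeg_comap_le F (Q'.comap h)).trans (resTrdeg_comap_le h Q')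
    have h3 : resTrdeg k Q' + s ≤ resTrdeg k Q + t := by
      rw [← hLt, ← hSt, ← hT]
      exact resTrdeg_add_eTrdeg_le Q'
    calc _ ≤ (((Q'.comap h).comap F).height + resTrdeg k ((Q'.comap h).comap F)) + s := by gcongr
      _ ≤ (((Q'.comap h).comap F).height + resTrdeg k Q') + s := by gcongr
      _ = ((Q'.comap h).comap F).height + (resTrdeg k Q' + s) := by ring
      _ ≤ ((Q'.comap h).comap F).height + (resTrdeg k Q + t) := by gcongr
      _ = _ := by ring
  have hqfin : resTrdeg k q ≠ ⊤ := ne_top_of_le_ne_top hB (resTrdeg_le_eTrdeg q)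
  have hHfin := height_polyExt_ne_top hB t q
  have hQfin : resTrdeg k Q ≠ ⊤ := by
    refine ne_top_of_le_ne_top ?_ (resTrdeg_tensor_le Q)
    rw [← hp, ← hq, hs']
    exact WithTop.add_ne_top.2 ⟨ENat.natCast_ne_top s, hqfin⟩
  have hmain (c : ℕ∞) := height_comap_add_le_height_comap_of_flat ιT.toRingHom hflat
    (h.comp F).toRingHom (RingHom.ker ε) (hP := RingHom.ker_isPrime ε.toRingHom) (c := c)
    (fun Q₁ Q₂ hQ₁ hQ₂ hlt hle hltT ↦ by
      refine hs (Q₁.comap h) (Q₂.comap h) (hQ₁.comap _) (hQ₂.comap _) ?_ ?_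
      · refine lt_of_le_of_ne (Ideal.comap_mono hlt.le) fun he ↦ hltT.ne ?_
        have := congrArg (Ideal.comap (Algebra.TensorProduct.includeLeft : T →ₐ[k] T ⊗[k] B)) he
        rwa [hhT, hhT] at this
      · rw [hhT]
        refine lt_of_lt_of_le hltT ?_
        rw [← hQp]
        exact Ideal.comap_mono hle)
  have hcomap : (RingHom.ker ε).comap (h.comp F).toRingHom = Q.comap F := by
    conv_rhs => rw [← hQh]
    rfl
  have hQp' : (RingHom.ker ε).comap ιT.toRingHom = p := hQp
  rw [hcomap, hQp'] at hmain
  by_cases htop : (Q.comap F).height = ⊤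
  · change _ ≤ (Q.comap F).height + _
    rw [htop, top_add]
    exact le_top
  change _ ≤ (Q.comap F).height + _
  have hpfin : p.height ≠ ⊤ := ne_top_of_le_ne_top (ENat.natCast_ne_top t) (hpt ▸ le_self_add)
  rw [hs'] at hpt
  generalize (polyExt t q).height = H at *
  generalize (Q.comap F).height = m at *
  generalize resTrdeg k Q = b at *
  generalize resTrdeg k q = d at *
  generalize p.height = e at *
  lift H to ℕ using hHfin
  lift m to ℕ using htop
  lift b to ℕ using hQfin
  lift d to ℕ using hqfin
  lift e to ℕ using hpfin
  norm_cast at hpt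
  have h5 := hmain ((H + t + d + s - (b + t) : ℕ) : ℕ∞) (fun Q' hQ' _ h0 ↦ by
    have h4 := hgen Q' hQ' h0
    change _ ≤ ((Q'.comap h).comap F).height
    rcases eq_or_ne ((Q'.comap h).comap F).height ⊤ with h6 | h6
    · rw [h6]
      exact le_top
    generalize ((Q'.comap h).comap F).height = z at *
    lift z to ℕ using h6
    norm_cast at h4 ⊢
    omega)
  norm_cast at h5 ⊢
  omega

end LowerBound

section FiberFormula

open Algebra.TensorProduct

variable {k : Type} [Field k]

theorem comap_includeLeft_comap_map {A T B C : Type} [CommRing A] [CommRing T] [CommRing B]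
    [CommRing C] [Algebra k A] [Algebra k T] [Algebra k B] [Algebra k C] (u : A →ₐ[k] T)
    (w : B →ₐ[k] C) (Q : Ideal (T ⊗[k] C)) :
    (Q.comap (Algebra.TensorProduct.map u w)).comap (includeLeft : A →ₐ[k] A ⊗[k] B) =
      (Q.comap (includeLeft : T →ₐ[k] T ⊗[k] C)).comap u := by
  ext x
  simp

theorem comap_includeRight_comap_map {A T B C : Type} [CommRing A] [CommRing T] [CommRing B]
    [CommRing C] [Algebra k A] [Algebra k T] [Algebra k B] [Algebra k C] (u : A →ₐ[k] T)
    (w : B →ₐ[k] C) (Q : Ideal (T ⊗[k] C)) :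
    (Q.comap (Algebra.TensorProduct.map u w)).comap (includeRight : B →ₐ[k] A ⊗[k] B) =
      (Q.comap (includeRight : C →ₐ[k] T ⊗[k] C)).comap w := by
  ext x
  simp

theorem comap_includeRight_comap_map_id {A T B : Type} [CommRing A] [CommRing T] [CommRing B]
    [Algebra k A] [Algebra k T] [Algebra k B] (u : A →ₐ[k] T) (Q : Ideal (T ⊗[k] B)) :
    (Q.comap (Algebra.TensorProduct.map u (AlgHom.id k B))).comap
      (includeRight : B →ₐ[k] A ⊗[k] B) = Q.comap (includeRight : B →ₐ[k] T ⊗[k] B) :=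
  comap_includeRight_comap_map u (AlgHom.id k B) Q

theorem height_add_resTrdeg_le_of_eTrdeg_eq {C B : Type} [CommRing C] [CommRing B] [Algebra k C]
    [Algebra k B] {t : ℕ} (hC : eTrdeg k C = t) (hB : eTrdeg k B ≠ ⊤) (P : Ideal (C ⊗[k] B))
    [hP : P.IsPrime] :
    P.height + resTrdeg k P ≤ t + resTrdeg k (P.comap (includeRight : B →ₐ[k] C ⊗[k] B)) +
      (polyExt t (P.comap (includeRight : B →ₐ[k] C ⊗[k] B))).height :=
  height_add_resTrdeg_le_of_forall _ t hB (fun P _ ↦ by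
    rw [← hC, add_comm]
    exact (resTrdeg_tensor_le P).trans (add_le_add_left (resTrdeg_le_eTrdeg _) _)) P

/-- The height formula for tensor products `C ⊗ B` at primes over an altitude-formula prime
of `C`. -/
theorem height_add_resTrdeg_eq {C B : Type} [CommRing C] [IsDomain C] [CommRing B] [Algebra k C]
    [Algebra k B] {t : ℕ} (hC : eTrdeg k C = t) (hB : eTrdeg k B ≠ ⊤) (P : Ideal (C ⊗[k] B))
    [hP : P.IsPrime]
    (hAF : (P.comap (includeLeft : C →ₐ[k] C ⊗[k] B)).height +
      resTrdeg k (P.comap (includeLeft : C →ₐ[k] C ⊗[k] B)) = t) :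
    P.height + resTrdeg k P = t + resTrdeg k (P.comap (includeRight : B →ₐ[k] C ⊗[k] B)) +
      (polyExt t (P.comap (includeRight : B →ₐ[k] C ⊗[k] B))).height := by
  refine le_antisymm (height_add_resTrdeg_le_of_eTrdeg_eq hC hB P) ?_
  have hid (I : Ideal (C ⊗[k] B)) :
      I.comap (Algebra.TensorProduct.map (AlgHom.id k C) (AlgHom.id k B)) = I := by
    rw [Algebra.TensorProduct.map_id]
    exact Ideal.comap_id I
  have h := le_height_comap_add_resTrdeg (AlgHom.id k C) Function.injective_id hC hC hB P rfl hAF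
    rfl (fun Q₁ Q₂ _ _ hlt _ ↦ by rwa [hid, hid])
  rw [hid] at h
  refine le_trans (le_of_eq ?_) h
  ring

/-- Version of `resTrdeg_add_height_polyExt_le` relative to a prime `q₁` of `B`. -/
theorem resTrdeg_add_height_polyExt_map_le {B R : Type} [CommRing B] [CommRing R] [Algebra k B]
    [Algebra k R] {t w : ℕ} (f : B →ₐ[k] R) {Q' Q : Ideal R} [hQ' : Q'.IsPrime] [hQ : Q.IsPrime]
    (hlt : Q' < Q) (hfin : resTrdeg k Q ≠ ⊤) (hw : resTrdeg k Q = resTrdeg k (Q.comap f) + w)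
    (hwt : w ≤ t) {q₁ : Ideal B} (hq₁ : q₁ ≤ Q'.comap f) :
    resTrdeg k (Q'.comap f) + (polyExt t ((Q'.comap f).map (Ideal.Quotient.mk q₁))).height +
      resTrdeg k Q + 1 ≤
      resTrdeg k (Q.comap f) + (polyExt t ((Q.comap f).map (Ideal.Quotient.mk q₁))).height +
      resTrdeg k Q' := by
  let f' : B ⧸ q₁ →ₐ[k] R ⧸ Q' := Ideal.quotientMapₐ Q' f hq₁
  have key (I : Ideal R) (hI : Q' ≤ I) : (I.map (Ideal.Quotient.mk Q')).comap f' =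
      (I.comap f).map (Ideal.Quotient.mk q₁) := by
    apply Ideal.comap_injective_of_surjective (Ideal.Quotient.mk q₁) Ideal.Quotient.mk_surjective
    rw [Ideal.comap_map_mk (hq₁.trans (Ideal.comap_mono hI))]
    conv_rhs => rw [← Ideal.comap_map_mk hI]
    rfl
  have htd {S : Type} [CommRing S] [Algebra k S] (J I : Ideal S) (hI : J ≤ I) :
      resTrdeg k (I.map (Ideal.Quotient.mk J)) = resTrdeg k I := by
    rw [← resTrdeg_comap_of_surjective (Ideal.Quotient.mkₐ k J) (Ideal.Quotient.mkₐ_surjective k J)]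
    exact congrArg (resTrdeg k) (Ideal.comap_map_mk hI)
  have hpr (I : Ideal R) [I.IsPrime] (hI : Q' ≤ I) : (I.map (Ideal.Quotient.mk Q')).IsPrime :=
    Ideal.map_isPrime_of_surjective Ideal.Quotient.mk_surjective (by rwa [Ideal.mk_ker])
  have := hpr Q hlt.le
  have := hpr Q' le_rfl
  have hlt' : Q'.map (Ideal.Quotient.mk Q') < Q.map (Ideal.Quotient.mk Q') := by
    refine lt_of_le_of_ne (Ideal.map_mono hlt.le) fun he ↦ hlt.ne ?_
    rw [← Ideal.comap_map_mk (le_refl Q'), he, Ideal.comap_map_mk hlt.le]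
  have h := resTrdeg_add_height_polyExt_le (t := t) (w := w) f' hlt'
  have hq : q₁ ≤ Q.comap f := hq₁.trans (Ideal.comap_mono hlt.le)
  simp only [key Q hlt.le, key Q' le_rfl, htd _ _ hlt.le, htd Q' Q' le_rfl, htd _ _ hq,
    htd _ _ hq₁] at h
  exact h hfin hw hwt

section Localization

variable {A T B : Type} [CommRing A] [CommRing T] [CommRing B] [Algebra k A] [Algebra k T]
  [Algebra k B] (u : A →ₐ[k] T) (W : Submonoid A)

theorem comap_map_lt_comap_map (hW : ∀ x, ∃ m ∈ W, ∃ y, u m * x = u y)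
    {Q₁ Q₂ : Ideal (T ⊗[k] B)} [hQ₁ : Q₁.IsPrime] (hlt : Q₁ < Q₂)
    (hWQ : ∀ m ∈ W, m ∉ (Q₁.comap (includeLeft : T →ₐ[k] T ⊗[k] B)).comap u) :
    Q₁.comap (Algebra.TensorProduct.map u (AlgHom.id k B)) <
      Q₂.comap (Algebra.TensorProduct.map u (AlgHom.id k B)) := by
  refine Ideal.comap_lt_comap_of_forall_exists_mul _ hlt fun z ↦ ?_
  obtain ⟨m, hm, y, h⟩ := exists_mul_eq_map_tensorProduct (B := B) u W hW z
  exact ⟨m ⊗ₜ 1, y, by simpa using hWQ m hm, by simpa using h⟩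

theorem resTrdeg_comap_map_eq (hW : ∀ x, ∃ m ∈ W, ∃ y, u m * x = u y)
    (Q : Ideal (T ⊗[k] B)) [hQ : Q.IsPrime]
    (hWQ : ∀ m ∈ W, m ∉ (Q.comap (includeLeft : T →ₐ[k] T ⊗[k] B)).comap u) :
    resTrdeg k (Q.comap (Algebra.TensorProduct.map u (AlgHom.id k B))) = resTrdeg k Q := by
  refine (resTrdeg_comap_le _ Q).antisymm (resTrdeg_le_resTrdeg_comap _ Q fun z ↦ ?_)
  obtain ⟨m, hm, y, h⟩ := exists_mul_eq_map_tensorProduct (B := B) u W hW z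
  exact ⟨m ⊗ₜ 1, y, by simpa using hWQ m hm, by simpa using h⟩

end Localization

theorem Ideal.exists_isPrime_comap_eq_of_forall_exists_mul {R S : Type} [CommRing R] [CommRing S]
    (f : R →+* S) (hf : Function.Injective f) (P : Ideal R) [hP : P.IsPrime] (m : R) (hm : m ∉ P)
    (h : ∀ z, ∃ y, f m * z = f y) : ∃ Q : Ideal S, Q.IsPrime ∧ Q.comap f = P := by
  rw [← Ideal.comap_map_eq_self_iff_of_isPrime]
  refine le_antisymm (fun x hx ↦ ?_) Ideal.le_comap_map
  have key : ∀ z ∈ P.map f, ∀ a, ∃ y ∈ P, f m * (a * z) = f y := by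
    intro z hz
    induction hz using Submodule.span_induction with
    | mem z hz =>
      obtain ⟨y, hy, rfl⟩ := hz
      intro a
      obtain ⟨b, hb⟩ := h a
      exact ⟨b * y, P.mul_mem_left _ hy, by rw [← mul_assoc, hb, map_mul]⟩
    | zero => exact fun a ↦ ⟨0, P.zero_mem, by simp⟩
    | add z₁ z₂ _ _ h₁ h₂ =>
      intro a
      obtain ⟨y₁, hy₁, h₁⟩ := h₁ a
      obtain ⟨y₂, hy₂, h₂⟩ := h₂ a
      exact ⟨y₁ + y₂, P.add_mem hy₁ hy₂, by rw [mul_add, mul_add, h₁, h₂, map_add]⟩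
    | smul c z _ hz =>
      intro a
      obtain ⟨y, hy, h⟩ := hz (a * c)
      exact ⟨y, hy, by rw [← h, smul_eq_mul, mul_assoc]⟩
  obtain ⟨y, hy, h⟩ := key (f x) hx 1
  rw [one_mul] at h
  rw [← map_mul] at h
  have : m * x ∈ P := hf h ▸ hy
  exact (hP.mem_or_mem this).resolve_left hm

end FiberFormula

section Conductor

open Algebra.TensorProduct

variable {k A T B : Type} [Field k] [CommRing A] [CommRing T] [CommRing B] [Algebra k A]
  [Algebra k T] [Algebra k B] {u : A →ₐ[k] T} {M : Ideal T}

theorem exists_mem_powers_mul_eq (huM : ∀ x ∈ M, ∃ a, u a = x) {a : A} (ha : u a ∈ M) (x : T) :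
    ∃ m ∈ Submonoid.powers a, ∃ y, u m * x = u y :=
  ⟨a, Submonoid.mem_powers a, (huM _ (M.mul_mem_right x ha)).imp fun _ h ↦ h.symm⟩

theorem exists_mul_eq_map_of_mem (huM : ∀ x ∈ M, ∃ a, u a = x) {z : T ⊗[k] B}
    (hz : z ∈ M.map (includeLeft : T →ₐ[k] T ⊗[k] B)) (w : T ⊗[k] B) :
    ∃ y ∈ (M.comap u).map (includeLeft : A →ₐ[k] A ⊗[k] B),
      w * z = Algebra.TensorProduct.map u (AlgHom.id k B) y := by
  induction hz using Submodule.span_induction generalizing w with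
  | mem z hz =>
    obtain ⟨x, hx, rfl⟩ := hz
    induction w with
    | zero => exact ⟨0, zero_mem _, by simp⟩
    | add w₁ w₂ h₁ h₂ =>
      obtain ⟨y₁, hy₁, h₁⟩ := h₁
      obtain ⟨y₂, hy₂, h₂⟩ := h₂
      exact ⟨y₁ + y₂, add_mem hy₁ hy₂, by rw [add_mul, h₁, h₂, map_add]⟩
    | tmul t b =>
      obtain ⟨a, ha⟩ := huM (t * x) (M.mul_mem_left _ hx)
      refine ⟨(1 ⊗ₜ b) * includeLeft a, Ideal.mul_mem_left _ _ (Ideal.mem_map_of_mem _ ?_), ?_⟩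
      · rw [Ideal.mem_comap, ha]
        exact M.mul_mem_left _ hx
      · simp [ha]
  | zero => exact ⟨0, zero_mem _, by simp⟩
  | add z₁ z₂ _ _ h₁ h₂ =>
    obtain ⟨y₁, hy₁, h₁⟩ := h₁ w
    obtain ⟨y₂, hy₂, h₂⟩ := h₂ w
    exact ⟨y₁ + y₂, add_mem hy₁ hy₂, by rw [mul_add, h₁, h₂, map_add]⟩
  | smul c z _ hz =>
    obtain ⟨y, hy, h⟩ := hz (w * c)
    exact ⟨y, hy, by rw [← h, smul_eq_mul, mul_assoc]⟩

theorem exists_comap_map_eq (hu : Function.Injective u) (huM : ∀ x ∈ M, ∃ a, u a = x)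
    (P : Ideal (A ⊗[k] B)) [hP : P.IsPrime]
    (hPM : ¬ M.comap u ≤ P.comap (includeLeft : A →ₐ[k] A ⊗[k] B)) :
    ∃ Q : Ideal (T ⊗[k] B), Q.IsPrime ∧ Q.comap (Algebra.TensorProduct.map u (AlgHom.id k B)) = P ∧
      resTrdeg k Q = resTrdeg k P := by
  obtain ⟨a, ha, haP⟩ := SetLike.not_le_iff_exists.1 hPM
  have hinj : Function.Injective (Algebra.TensorProduct.map u (AlgHom.id k B)) :=
    TensorProduct.map_injective_of_flat_flat u.toLinearMap LinearMap.id hu Function.injective_id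
  obtain ⟨Q, hQ, hQP⟩ := Ideal.exists_isPrime_comap_eq_of_forall_exists_mul
    (Algebra.TensorProduct.map u (AlgHom.id k B)).toRingHom hinj P (a ⊗ₜ 1) haP (fun z ↦ by
      obtain ⟨y, -, h⟩ := exists_mul_eq_map_of_mem huM
        (Ideal.mem_map_of_mem (includeLeft : T →ₐ[k] T ⊗[k] B) (show u a ∈ M from ha)) z
      exact ⟨y, by rw [mul_comm]; simpa using h⟩)
  refine ⟨Q, hQ, hQP, ?_⟩
  have hQP' : Q.comap (Algebra.TensorProduct.map u (AlgHom.id k B)) = P := hQP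
  rw [← hQP', resTrdeg_comap_map_eq u _ (exists_mem_powers_mul_eq huM ha)]
  rintro _ ⟨n, rfl⟩ h
  rw [← comap_includeLeft_comap_map u (AlgHom.id k B), hQP'] at h
  exact haP (Ideal.IsPrime.mem_of_pow_mem inferInstance n h)

variable [IsDomain A] [IsDomain T]

theorem height_add_resTrdeg_eq_of_not_le {t : ℕ} (hu : Function.Injective u)
    (huM : ∀ x ∈ M, ∃ a, u a = x) (hA : eTrdeg k A = t) (hT : eTrdeg k T = t)
    (hAF : ∀ p : Ideal T, p.IsPrime → p.height + resTrdeg k p = t)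
    (hB : eTrdeg k B ≠ ⊤) (P : Ideal (A ⊗[k] B)) [hP : P.IsPrime]
    (hPM : ¬ M.comap u ≤ P.comap (includeLeft : A →ₐ[k] A ⊗[k] B)) :
    P.height + resTrdeg k P = t + resTrdeg k (P.comap (includeRight : B →ₐ[k] A ⊗[k] B)) +
      (polyExt t (P.comap (includeRight : B →ₐ[k] A ⊗[k] B))).height := by
  refine le_antisymm (height_add_resTrdeg_le_of_eTrdeg_eq hA hB P) ?_
  obtain ⟨Q, hQ, rfl, htd⟩ := exists_comap_map_eq hu huM P hPM
  obtain ⟨a, ha, haP⟩ := SetLike.not_le_iff_exists.1 hPM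
  rw [comap_includeLeft_comap_map] at haP
  rw [comap_includeRight_comap_map_id, ← htd]
  have h := le_height_comap_add_resTrdeg u hu hA hT hB Q rfl (hAF _ (hQ.comap _)) rfl
    (fun Q₁ Q₂ hQ₁ _ hlt hQ₁Q ↦ comap_map_lt_comap_map u _ (exists_mem_powers_mul_eq huM ha) hlt (by
      rintro _ ⟨n, rfl⟩ h
      rw [← comap_includeLeft_comap_map u (AlgHom.id k B)] at h
      have h := Ideal.IsPrime.mem_of_pow_mem inferInstance n h
      rw [comap_includeLeft_comap_map u (AlgHom.id k B)] at h
      exact haP (Ideal.comap_mono hQ₁Q.le h)))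
  refine le_trans (le_of_eq ?_) h
  ring

end Conductor

section UpperBound

open Algebra.TensorProduct

/-- The contribution of an intermediate prime `q₁ ≤ q` of `B` to the height of a prime of `A ⊗ B`
over `q` whose contraction to the pullback `A` contains the conductor. -/
def conductorBound (k : Type) {B : Type} [Field k] [CommRing B] [Algebra k B] (t d e : ℕ)
    (q₁ q : Ideal B) : ℕ∞ :=
  (polyExt d (q.map (Ideal.Quotient.mk q₁))).height + (polyExt t q₁).height +
    min (t : ℕ∞) (e + d + resTrdeg k q₁)

variable {k A T B : Type} [Field k] [CommRing A] [CommRing T] [CommRing B] [Algebra k A]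
  [Algebra k T] [Algebra k B] {u : A →ₐ[k] T} {M : Ideal T}

theorem Ideal.isPrime_map_mk_of_le {R : Type} [CommRing R] {I J : Ideal R} [J.IsPrime] (h : I ≤ J) :
    (J.map (Ideal.Quotient.mk I)).IsPrime :=
  Ideal.map_isPrime_of_surjective Ideal.Quotient.mk_surjective (by rwa [Ideal.mk_ker])

theorem eTrdeg_quotient_ne_top (hB : eTrdeg k B ≠ ⊤) (q : Ideal B) : eTrdeg k (B ⧸ q) ≠ ⊤ :=
  ne_top_of_le_ne_top hB (resTrdeg_le_eTrdeg q)

theorem exists_height_add_resTrdeg_le_of_not_le [hM : M.IsMaximal] {t d m e : ℕ}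
    (hu : Function.Injective u) (huM : ∀ x ∈ M, ∃ a, u a = x) (hA : eTrdeg k A = t)
    (hm : resTrdeg k M = m) (hme : m + e = t)
    (hd : resTrdeg k (M.comap u) = d) (hB : eTrdeg k B ≠ ⊤) {P' P : Ideal (A ⊗[k] B)}
    [hP' : P'.IsPrime] [hP : P.IsPrime] (hlt : P' < P)
    (hP'M : ¬ M.comap u ≤ P'.comap (includeLeft : A →ₐ[k] A ⊗[k] B))
    (hPM : M.comap u ≤ P.comap (includeLeft : A →ₐ[k] A ⊗[k] B)) :
    ∃ R : Ideal (A ⊗[k] B), R.IsPrime ∧ R ≤ P ∧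
      M.comap u ≤ R.comap (includeLeft : A →ₐ[k] A ⊗[k] B) ∧
      P'.height + 1 + resTrdeg k R ≤ resTrdeg k (R.comap (includeRight : B →ₐ[k] A ⊗[k] B)) +
        (polyExt t (R.comap (includeRight : B →ₐ[k] A ⊗[k] B))).height +
        min (t : ℕ∞) (e + d + resTrdeg k (R.comap (includeRight : B →ₐ[k] A ⊗[k] B))) := by
  let F := Algebra.TensorProduct.map u (AlgHom.id k B)
  obtain ⟨Q', hQ', hQ'P, htd⟩ := exists_comap_map_eq hu huM P' hP'M
  let I : Ideal (T ⊗[k] B) := M.map (includeLeft : T →ₐ[k] T ⊗[k] B) ⊔ Q'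
  have hIP : I.comap F ≤ P := by
    intro x hx
    obtain ⟨z, hz, z', hz', h⟩ := Submodule.mem_sup.1 (show F x ∈ I from hx)
    obtain ⟨y, hy, hy'⟩ := exists_mul_eq_map_of_mem huM hz 1
    rw [one_mul] at hy'
    have h1 : x - y ∈ P' := by
      rw [← hQ'P, Ideal.mem_comap, map_sub, ← hy']
      change F x - z ∈ Q'
      rw [← h, add_sub_cancel_left]
      exact hz'
    have h2 : y ∈ P := Ideal.map_le_iff_le_comap.2 hPM hy
    exact (sub_add_cancel x y) ▸ P.add_mem (hlt.le h1) h2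
  obtain ⟨R, hR, hRP⟩ := Ideal.exists_minimalPrimes_le hIP
  obtain ⟨Q, hQ, hIQ, hQR⟩ := Ideal.exists_comap_eq_of_mem_minimalPrimes F.toRingHom R hR
  have hQR : Q.comap F = R := hQR
  have hRprime : R.IsPrime := hR.1.1
  have hQM : Q.comap (includeLeft : T →ₐ[k] T ⊗[k] B) = M := by
    refine (hM.eq_of_le (Ideal.IsPrime.ne_top inferInstance) ?_).symm
    exact Ideal.map_le_iff_le_comap.1 (le_sup_left.trans hIQ)
  have hRM : M.comap u ≤ R.comap (includeLeft : A →ₐ[k] A ⊗[k] B) := by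
    rw [← hQR, comap_includeLeft_comap_map u (AlgHom.id k B), hQM]
  have hQlt : Q' < Q := by
    refine lt_of_le_of_ne (le_sup_right.trans hIQ) fun he ↦ hP'M ?_
    rw [← hQ'P, he]
    change _ ≤ (Q.comap F).comap _
    rwa [hQR]
  refine ⟨R, hRprime, hRP, hRM, ?_⟩
  have hQB : Q.comap (includeRight : B →ₐ[k] T ⊗[k] B) =
      R.comap (includeRight : B →ₐ[k] A ⊗[k] B) := by
    rw [← hQR, comap_includeRight_comap_map_id]
  have hQ'B : Q'.comap (includeRight : B →ₐ[k] T ⊗[k] B) =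
      P'.comap (includeRight : B →ₐ[k] A ⊗[k] B) := by
    rw [← hQ'P, comap_includeRight_comap_map_id]
  have h1 := height_add_resTrdeg_le_of_eTrdeg_eq hA hB P'
  have h2 := fun w ↦ resTrdeg_add_height_polyExt_le (t := t) (w := w)
    (includeRight : B →ₐ[k] T ⊗[k] B) hQlt
  have h3 := resTrdeg_tensor_le Q
  have h4 := resTrdeg_comap_le (includeRight : B →ₐ[k] T ⊗[k] B) Q
  have h5 := resTrdeg_comap_le (includeLeft : T →ₐ[k] T ⊗[k] B) Q
  have h6 := resTrdeg_tensor_le R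
  have h7 : resTrdeg k (R.comap (includeLeft : A →ₐ[k] A ⊗[k] B)) ≤ d :=
    hd ▸ resTrdeg_le_of_le hRM
  have h8 : resTrdeg k R ≤ resTrdeg k Q := hQR ▸ resTrdeg_comap_le F Q
  have h9 := resTrdeg_tensor_le P'
  have h10 : resTrdeg k (P'.comap (includeLeft : A →ₐ[k] A ⊗[k] B)) ≤ t :=
    hA ▸ resTrdeg_le_eTrdeg _
  have hq (q : Ideal B) : resTrdeg k q ≠ ⊤ := ne_top_of_le_ne_top hB (resTrdeg_le_eTrdeg q)
  rw [hQM, hm] at h3 h5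
  rw [hQB] at h2 h3 h4
  rw [hQ'B, htd] at h2
  have i1 := hq (R.comap (includeRight : B →ₐ[k] A ⊗[k] B))
  have i2 := hq (P'.comap (includeRight : B →ₐ[k] A ⊗[k] B))
  have i3 := height_polyExt_ne_top hB t (R.comap (includeRight : B →ₐ[k] A ⊗[k] B))
  have i4 := height_polyExt_ne_top hB t (P'.comap (includeRight : B →ₐ[k] A ⊗[k] B))
  have i5 : resTrdeg k P' ≠ ⊤ := ne_top_of_le_ne_top
    (WithTop.add_ne_top.2 ⟨ne_top_of_le_ne_top (ENat.natCast_ne_top t) h10, i2⟩) h9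
  have i6 : resTrdeg k Q ≠ ⊤ := ne_top_of_le_ne_top
    (WithTop.add_ne_top.2 ⟨ENat.natCast_ne_top m, i1⟩) h3
  have i7 : resTrdeg k R ≠ ⊤ := ne_top_of_le_ne_top i6 h8
  have i8 : P'.height ≠ ⊤ := ne_top_of_le_ne_top (WithTop.add_ne_top.2
    ⟨WithTop.add_ne_top.2 ⟨ENat.natCast_ne_top t, i2⟩, i4⟩) (le_self_add.trans h1)
  clear hq h9 h10
  generalize resTrdeg k (R.comap (includeRight : B →ₐ[k] A ⊗[k] B)) = a₁ at *
  generalize resTrdeg k (P'.comap (includeRight : B →ₐ[k] A ⊗[k] B)) = a₂ at *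
  generalize (polyExt t (R.comap (includeRight : B →ₐ[k] A ⊗[k] B))).height = a₃ at *
  generalize (polyExt t (P'.comap (includeRight : B →ₐ[k] A ⊗[k] B))).height = a₄ at *
  generalize resTrdeg k P' = a₅ at *
  generalize resTrdeg k Q = a₆ at *
  generalize resTrdeg k R = a₇ at *
  generalize P'.height = a₈ at *
  have h6 := h6.trans (add_le_add_left h7 _)
  clear h7
  lift a₁ to ℕ using i1
  lift a₂ to ℕ using i2
  lift a₃ to ℕ using i3
  lift a₄ to ℕ using i4
  lift a₅ to ℕ using i5
  lift a₆ to ℕ using i6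
  lift a₇ to ℕ using i7
  lift a₈ to ℕ using i8
  rw [← min_add_add_left]
  norm_cast at *
  have h2 := h2 (a₆ - a₁) (by simp) (by omega) (by omega)
  refine le_min ?_ ?_ <;> norm_cast <;> omega

/-- Upper bound for the height of a prime of `A ⊗ B` over the conductor of a pullback `A`. -/
theorem exists_height_add_resTrdeg_le [hM : M.IsMaximal] {t d m e : ℕ}
    (hu : Function.Injective u) (huM : ∀ x ∈ M, ∃ a, u a = x) (hA : eTrdeg k A = t)
    (hm : resTrdeg k M = m) (hme : m + e = t)
    (hd : resTrdeg k (M.comap u) = d) (hB : eTrdeg k B ≠ ⊤) (P : Ideal (A ⊗[k] B))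
    [hP : P.IsPrime] (hPM : M.comap u ≤ P.comap (includeLeft : A →ₐ[k] A ⊗[k] B)) :
    ∃ q₁ : Ideal B, q₁.IsPrime ∧ q₁ ≤ P.comap (includeRight : B →ₐ[k] A ⊗[k] B) ∧
      P.height + resTrdeg k P ≤ resTrdeg k (P.comap (includeRight : B →ₐ[k] A ⊗[k] B)) +
        conductorBound k t d e q₁ (P.comap (includeRight : B →ₐ[k] A ⊗[k] B)) := by
  have hdt : d ≤ t := by
    have : (d : ℕ∞) ≤ t := by
      rw [← hd, ← hA]
      exact resTrdeg_le_eTrdeg _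
    exact_mod_cast this
  have hq (q : Ideal B) : resTrdeg k q ≠ ⊤ := ne_top_of_le_ne_top hB (resTrdeg_le_eTrdeg q)
  have htd (P : Ideal (A ⊗[k] B)) (hP : P.IsPrime)
      (hPM : M.comap u ≤ P.comap (includeLeft : A →ₐ[k] A ⊗[k] B)) :
      resTrdeg k P ≤ d + resTrdeg k (P.comap (includeRight : B →ₐ[k] A ⊗[k] B)) :=
    (resTrdeg_tensor_le P).trans (add_le_add_left (hd ▸ resTrdeg_le_of_le hPM) _)
  have htdfin (P : Ideal (A ⊗[k] B)) (hP : P.IsPrime)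
      (hPM : M.comap u ≤ P.comap (includeLeft : A →ₐ[k] A ⊗[k] B)) : resTrdeg k P ≠ ⊤ :=
    ne_top_of_le_ne_top (WithTop.add_ne_top.2 ⟨ENat.natCast_ne_top d, hq _⟩) (htd P hP hPM)
  have hH (q₁ q : Ideal B) (hq : q.IsPrime) (hle : q₁ ≤ q) :
      (polyExt d (q.map (Ideal.Quotient.mk q₁))).height ≠ ⊤ := by
    have := Ideal.isPrime_map_mk_of_le hle
    exact height_polyExt_ne_top (eTrdeg_quotient_ne_top hB q₁) d _
  -- the inequality of `resTrdeg_add_height_polyExt_map_le` for primes over the conductor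
  have step (P' P : Ideal (A ⊗[k] B)) (hP' : P'.IsPrime) (hP : P.IsPrime) (hlt : P' < P)
      (hPM : M.comap u ≤ P.comap (includeLeft : A →ₐ[k] A ⊗[k] B)) (q₁ : Ideal B)
      (hq₁ : q₁ ≤ P'.comap (includeRight : B →ₐ[k] A ⊗[k] B)) :
      resTrdeg k (P'.comap (includeRight : B →ₐ[k] A ⊗[k] B)) +
          (polyExt d ((P'.comap (includeRight : B →ₐ[k] A ⊗[k] B)).map
            (Ideal.Quotient.mk q₁))).height + resTrdeg k P + 1 ≤
        resTrdeg k (P.comap (includeRight : B →ₐ[k] A ⊗[k] B)) +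
          (polyExt d ((P.comap (includeRight : B →ₐ[k] A ⊗[k] B)).map
            (Ideal.Quotient.mk q₁))).height + resTrdeg k P' := by
    obtain ⟨w, hw⟩ := exists_add_of_le (resTrdeg_comap_le (includeRight : B →ₐ[k] A ⊗[k] B) P)
    have hwd : w ≤ d := by
      have := htd P hP hPM
      rw [hw, add_comm] at this
      exact (ENat.add_le_add_iff_right (hq _)).1 this
    lift w to ℕ using ne_top_of_le_ne_top (ENat.natCast_ne_top d) hwd
    exact resTrdeg_add_height_polyExt_map_le (t := d) (includeRight : B →ₐ[k] A ⊗[k] B) hlt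
      (htdfin P hP hPM) hw (by exact_mod_cast hwd) hq₁
  have key (n : ℕ) : ∀ (P : Ideal (A ⊗[k] B)), P.IsPrime →
      M.comap u ≤ P.comap (includeLeft : A →ₐ[k] A ⊗[k] B) → (n : ℕ∞) ≤ P.height →
      ∃ q₁ : Ideal B, q₁.IsPrime ∧ q₁ ≤ P.comap (includeRight : B →ₐ[k] A ⊗[k] B) ∧
        n + resTrdeg k P ≤ resTrdeg k (P.comap (includeRight : B →ₐ[k] A ⊗[k] B)) +
        conductorBound k t d e q₁ (P.comap (includeRight : B →ₐ[k] A ⊗[k] B)) := by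
    induction n with
    | zero =>
      intro P hP hPM _
      refine ⟨_, hP.comap _, le_rfl, ?_⟩
      have h1 : (d : ℕ∞) ≤ min (t : ℕ∞)
          (e + d + resTrdeg k (P.comap (includeRight : B →ₐ[k] A ⊗[k] B))) :=
        le_min (by exact_mod_cast hdt) (le_add_right le_add_self)
      rw [Nat.cast_zero, zero_add]
      refine (htd P hP hPM).trans ?_
      rw [add_comm]
      exact add_le_add_right (h1.trans le_add_self) _
    | succ n ih =>
      intro P hP hPM hn
      obtain ⟨P', hP', hlt, hn'⟩ := exists_lt_of_add_one_le_height hn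
      by_cases hP'M : M.comap u ≤ P'.comap (includeLeft : A →ₐ[k] A ⊗[k] B)
      · obtain ⟨q₁, hq₁, hq₁P', h1⟩ := ih P' hP' hP'M hn'
        have hq₁P := hq₁P'.trans (Ideal.comap_mono hlt.le)
        refine ⟨q₁, hq₁, hq₁P, ?_⟩
        have h2 := step P' P hP' hP hlt hPM q₁ hq₁P'
        have i1 := htdfin P hP hPM
        have i2 := htdfin P' hP' hP'M
        have i3 := hq (P.comap (includeRight : B →ₐ[k] A ⊗[k] B))
        have i4 := hq (P'.comap (includeRight : B →ₐ[k] A ⊗[k] B))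
        have i5 := hH q₁ _ (hP.comap (includeRight : B →ₐ[k] A ⊗[k] B)) hq₁P
        have i6 := hH q₁ _ (hP'.comap (includeRight : B →ₐ[k] A ⊗[k] B)) hq₁P'
        have i7 := height_polyExt_ne_top hB t q₁
        have i8 := hq q₁
        have i9 : min (t : ℕ∞) (e + d + resTrdeg k q₁) ≠ ⊤ :=
          ne_top_of_le_ne_top (ENat.natCast_ne_top t) (min_le_left _ _)
        unfold conductorBound at h1 ⊢
        generalize min (t : ℕ∞) (e + d + resTrdeg k q₁) = b₁ at *
        generalize resTrdeg k P = b₂ at *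
        generalize resTrdeg k P' = b₃ at *
        generalize resTrdeg k (P.comap (includeRight : B →ₐ[k] A ⊗[k] B)) = b₄ at *
        generalize resTrdeg k (P'.comap (includeRight : B →ₐ[k] A ⊗[k] B)) = b₅ at *
        generalize (polyExt d ((P.comap (includeRight : B →ₐ[k] A ⊗[k] B)).map
            (Ideal.Quotient.mk q₁))).height = b₆ at *
        generalize (polyExt d ((P'.comap (includeRight : B →ₐ[k] A ⊗[k] B)).map
            (Ideal.Quotient.mk q₁))).height = b₇ at *
        generalize (polyExt t q₁).height = b₈ at *
        clear i8 step hH htdfin htd hq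
        lift b₁ to ℕ using i9
        lift b₂ to ℕ using i1
        lift b₃ to ℕ using i2
        lift b₄ to ℕ using i3
        lift b₅ to ℕ using i4
        lift b₆ to ℕ using i5
        lift b₇ to ℕ using i6
        lift b₈ to ℕ using i7
        norm_cast at *
        omega
      · obtain ⟨R, hR, hRP, hRM, h1⟩ := exists_height_add_resTrdeg_le_of_not_le hu huM hA hm
          hme hd hB hlt hP'M hPM
        refine ⟨_, hR.comap (includeRight : B →ₐ[k] A ⊗[k] B), Ideal.comap_mono hRP, ?_⟩
        have hn1 : (n : ℕ∞) + 1 + resTrdeg k R ≤ _ :=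
          (add_le_add_left (add_le_add_left hn' 1) _).trans h1
        rcases hRP.eq_or_lt with rfl | hRP
        · rw [Nat.cast_add, Nat.cast_one]
          refine hn1.trans ?_
          rw [conductorBound, add_assoc]
          exact add_le_add_right (add_le_add_left le_add_self _) _
        · have h2 := step R P hR hP hRP hPM _ le_rfl
          have i1 := htdfin P hP hPM
          have i2 := htdfin R hR hRM
          have i3 := hq (P.comap (includeRight : B →ₐ[k] A ⊗[k] B))
          have i4 := hq (R.comap (includeRight : B →ₐ[k] A ⊗[k] B))
          have i5 := hH _ _ (hP.comap (includeRight : B →ₐ[k] A ⊗[k] B)) (Ideal.comap_mono hRP.le)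
          have i7 := height_polyExt_ne_top hB t (R.comap (includeRight : B →ₐ[k] A ⊗[k] B))
          have i9 : min (t : ℕ∞) (e + d + resTrdeg k (R.comap
              (includeRight : B →ₐ[k] A ⊗[k] B))) ≠ ⊤ :=
            ne_top_of_le_ne_top (ENat.natCast_ne_top t) (min_le_left _ _)
          have h2 := (add_le_add_left (add_le_add_left le_self_add _) _).trans h2
          unfold conductorBound
          generalize min (t : ℕ∞) (e + d + resTrdeg k (R.comap
            (includeRight : B →ₐ[k] A ⊗[k] B))) = b₁ at *
          generalize (polyExt d ((P.comap (includeRight : B →ₐ[k] A ⊗[k] B)).map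
            (Ideal.Quotient.mk (R.comap (includeRight : B →ₐ[k] A ⊗[k] B))))).height = b₆ at *
          generalize (polyExt t (R.comap (includeRight : B →ₐ[k] A ⊗[k] B))).height = b₈ at *
          generalize resTrdeg k P = b₂ at *
          generalize resTrdeg k R = b₃ at *
          generalize resTrdeg k (P.comap (includeRight : B →ₐ[k] A ⊗[k] B)) = b₄ at *
          generalize resTrdeg k (R.comap (includeRight : B →ₐ[k] A ⊗[k] B)) = b₅ at *
          clear step hH htdfin htd hq h1
          lift b₁ to ℕ using i9
          lift b₂ to ℕ using i1
          lift b₃ to ℕ using i2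
          lift b₄ to ℕ using i3
          lift b₅ to ℕ using i4
          lift b₆ to ℕ using i5
          lift b₈ to ℕ using i7
          norm_cast at *
          omega
  have hfin : P.height ≠ ⊤ := ne_top_of_le_ne_top (WithTop.add_ne_top.2
    ⟨WithTop.add_ne_top.2 ⟨ENat.natCast_ne_top t, hq _⟩, height_polyExt_ne_top hB t _⟩)
    (le_self_add.trans (height_add_resTrdeg_le_of_eTrdeg_eq hA hB P))
  obtain ⟨n, hn⟩ := ENat.ne_top_iff_exists.1 hfin
  rw [← hn]
  exact key n P hP hPM hn.le

end UpperBound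

section Compositum

/-- A field extension embeds into the algebraic closure of one of at least its transcendence
degree. -/
theorem nonempty_algHom_algebraicClosure {C K L : Type} [CommRing C] [IsDomain C] [Field K]
    [Field L] [Algebra C K] [Algebra C L] [FaithfulSMul C K] [FaithfulSMul C L] {n m : ℕ}
    (hn : eTrdeg C K = n) (hm : eTrdeg C L = m) (h : n ≤ m) :
    Nonempty (K →ₐ[C] AlgebraicClosure L) := by
  obtain ⟨x, hx⟩ := exists_algebraicIndependent_of_eTrdeg_eq hn
  obtain ⟨y, hy⟩ := exists_algebraicIndependent_of_eTrdeg_eq hm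
  let ι : L →ₐ[C] AlgebraicClosure L := IsScalarTower.toAlgHom C L (AlgebraicClosure L)
  have hz : AlgebraicIndependent C ((ι ∘ y) ∘ Fin.castLE h) :=
    (hy.1.map' (f := ι) ι.toRingHom.injective).comp _ (Fin.castLE_injective h)
  let g : Algebra.adjoin C (Set.range x) →ₐ[C] AlgebraicClosure L :=
    (MvPolynomial.aeval ((ι ∘ y) ∘ Fin.castLE h)).comp hx.1.repr
  have hg : Function.Injective g :=
    Function.Injective.comp (g := MvPolynomial.aeval ((ι ∘ y) ∘ Fin.castLE h)) hz
      hx.1.aevalEquiv.symm.injective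
  have := hx.isAlgebraic
  algebraize [g.toRingHom]
  have : FaithfulSMul (Algebra.adjoin C (Set.range x)) (AlgebraicClosure L) :=
    (faithfulSMul_iff_algebraMap_injective _ _).2 hg
  have : IsScalarTower C (Algebra.adjoin C (Set.range x)) (AlgebraicClosure L) :=
    .of_algebraMap_eq' g.comp_algebraMap.symm
  exact ⟨(IsAlgClosed.lift : K →ₐ[Algebra.adjoin C (Set.range x)]
    AlgebraicClosure L).restrictScalars C⟩

theorem eTrdeg_algebraicClosure (k L : Type) [Field k] [Field L] [Algebra k L] :
    eTrdeg k (AlgebraicClosure L) = eTrdeg k L := by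
  rw [← eTrdeg_add_eq k L (AlgebraicClosure L), eTrdeg_eq_zero (k := L), add_zero]

theorem exists_field_algHom_comp_eq {k C K L : Type} [Field k] [CommRing C] [IsDomain C] [Field K]
    [Field L] [Algebra k C] [Algebra k K] [Algebra k L] (f : C →ₐ[k] K) (g : C →ₐ[k] L)
    (hf : Function.Injective f) (hg : Function.Injective g) (hK : eTrdeg k K ≠ ⊤)
    (hL : eTrdeg k L ≠ ⊤) :
    ∃ (Ω : Type) (_ : Field Ω) (_ : Algebra k Ω) (f' : K →ₐ[k] Ω) (g' : L →ₐ[k] Ω),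
      f'.comp f = g'.comp g ∧ eTrdeg k Ω ≤ max (eTrdeg k K) (eTrdeg k L) := by
  algebraize [f.toRingHom, g.toRingHom]
  have : IsScalarTower k C K := .of_algebraMap_eq' f.comp_algebraMap.symm
  have : IsScalarTower k C L := .of_algebraMap_eq' g.comp_algebraMap.symm
  have : FaithfulSMul C K := (faithfulSMul_iff_algebraMap_injective _ _).2 hf
  have : FaithfulSMul C L := (faithfulSMul_iff_algebraMap_injective _ _).2 hg
  have h1 := eTrdeg_add_eq k C K
  have h2 := eTrdeg_add_eq k C L
  obtain ⟨n, hn⟩ := ENat.ne_top_iff_exists.1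
    (ne_top_of_le_ne_top hK (h1 ▸ le_add_self : eTrdeg C K ≤ eTrdeg k K))
  obtain ⟨m, hm⟩ := ENat.ne_top_iff_exists.1
    (ne_top_of_le_ne_top hL (h2 ▸ le_add_self : eTrdeg C L ≤ eTrdeg k L))
  rcases le_total n m with h | h
  · obtain ⟨φ⟩ := nonempty_algHom_algebraicClosure hn.symm hm.symm h
    refine ⟨AlgebraicClosure L, inferInstance, inferInstance, φ.restrictScalars k,
      IsScalarTower.toAlgHom k L _, ?_, ?_⟩
    · ext c
      exact φ.commutes c
    · rw [eTrdeg_algebraicClosure]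
      exact le_max_right _ _
  · obtain ⟨φ⟩ := nonempty_algHom_algebraicClosure hm.symm hn.symm h
    refine ⟨AlgebraicClosure K, inferInstance, inferInstance, IsScalarTower.toAlgHom k K _,
      φ.restrictScalars k, ?_, ?_⟩
    · ext c
      exact (φ.commutes c).symm
    · rw [eTrdeg_algebraicClosure]
      exact le_max_left _ _

end Compositum

section Quotient

open Algebra.TensorProduct

variable {k A B : Type} [Field k] [CommRing A] [CommRing B] [Algebra k A] [Algebra k B]

theorem height_add_resTrdeg_of_comap_eq_bot [IsDomain A] [IsDomain B] {t : ℕ} (hA : eTrdeg k A = t)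
    (hB : eTrdeg k B ≠ ⊤) (P : Ideal (A ⊗[k] B)) [hP : P.IsPrime]
    (hPA : P.comap (includeLeft : A →ₐ[k] A ⊗[k] B) = ⊥)
    (hPB : P.comap (includeRight : B →ₐ[k] A ⊗[k] B) = ⊥) :
    P.height + resTrdeg k P = t + eTrdeg k B := by
  rw [height_add_resTrdeg_eq hA hB P (by rw [hPA, Ideal.height_bot, resTrdeg_bot, zero_add, hA]),
    hPB, resTrdeg_bot, polyExt, Ideal.map_bot, Ideal.height_bot, add_zero]

theorem Ideal.eq_bot_of_height_eq_zero {R : Type} [CommRing R] [IsDomain R] {p : Ideal R}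
    [p.IsPrime] (h : p.height = 0) : p = ⊥ := by
  rw [Ideal.height_eq_zero_iff, IsDomain.minimalPrimes_eq_singleton_bot] at h
  exact h

theorem height_comap_le_of_flat {R S : Type} [CommRing R] [CommRing S] {g : R →+* S} (hg : g.Flat)
    (P : Ideal S) [P.IsPrime] : (P.comap g).height ≤ P.height := by
  have := height_comap_add_le_height_comap_of_flat g hg (RingHom.id S) P (c := 0)
    (fun _ _ _ _ h _ _ ↦ h) (fun _ _ _ _ ↦ zero_le)
  rwa [add_zero, Ideal.comap_id] at this

theorem comap_eq_bot_of_height_eq_zero [IsDomain A] [IsDomain B] (P : Ideal (A ⊗[k] B))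
    [hP : P.IsPrime] (h : P.height = 0) :
    P.comap (includeLeft : A →ₐ[k] A ⊗[k] B) = ⊥ ∧
      P.comap (includeRight : B →ₐ[k] A ⊗[k] B) = ⊥ := by
  have hl : (includeLeft : A →ₐ[k] A ⊗[k] B).toRingHom.Flat :=
    RingHom.flat_algebraMap_iff.2 inferInstance
  have hr : (includeRight : B →ₐ[k] A ⊗[k] B).toRingHom.Flat := by
    have h1 : (includeLeft : B →ₐ[k] B ⊗[k] A).toRingHom.Flat :=
      RingHom.flat_algebraMap_iff.2 inferInstance
    have h2 := h1.comp (RingHom.Flat.of_bijective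
      (f := (Algebra.TensorProduct.comm k B A).toRingHom) (Algebra.TensorProduct.comm k B A).bijective)
    convert h2 using 1
    ext b
    simp
  exact ⟨Ideal.eq_bot_of_height_eq_zero (nonpos_iff_eq_zero.1 (h ▸ height_comap_le_of_flat hl P)),
    Ideal.eq_bot_of_height_eq_zero (nonpos_iff_eq_zero.1 (h ▸ height_comap_le_of_flat hr P))⟩

variable (k) in
/-- The surjection `A ⊗ B → A/p ⊗ B/q`. -/
def tensorQuotientMap (p : Ideal A) (q : Ideal B) : A ⊗[k] B →ₐ[k] (A ⧸ p) ⊗[k] (B ⧸ q) :=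
  Algebra.TensorProduct.map (Ideal.Quotient.mkₐ k p) (Ideal.Quotient.mkₐ k q)

variable (p : Ideal A) (q : Ideal B)

theorem tensorQuotientMap_surjective : Function.Surjective (tensorQuotientMap k p q) :=
  TensorProduct.map_surjective (Ideal.Quotient.mkₐ_surjective k p)
    (Ideal.Quotient.mkₐ_surjective k q)

theorem ker_tensorQuotientMap : RingHom.ker (tensorQuotientMap k p q) =
    p.map (includeLeft : A →ₐ[k] A ⊗[k] B) ⊔ q.map (includeRight : B →ₐ[k] A ⊗[k] B) := by
  rw [tensorQuotientMap, Algebra.TensorProduct.map_ker _ _ (Ideal.Quotient.mkₐ_surjective k p)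
    (Ideal.Quotient.mkₐ_surjective k q)]
  congr 2 <;> exact Ideal.mk_ker

variable {p q}

theorem exists_comap_tensorQuotientMap_eq (P : Ideal (A ⊗[k] B)) [hP : P.IsPrime]
    (hp : p ≤ P.comap (includeLeft : A →ₐ[k] A ⊗[k] B))
    (hq : q ≤ P.comap (includeRight : B →ₐ[k] A ⊗[k] B)) :
    ∃ P' : Ideal ((A ⧸ p) ⊗[k] (B ⧸ q)), P'.IsPrime ∧ P'.comap (tensorQuotientMap k p q) = P := by
  have hker : RingHom.ker (tensorQuotientMap k p q) ≤ P := by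
    rw [ker_tensorQuotientMap]
    exact sup_le (Ideal.map_le_iff_le_comap.2 hp) (Ideal.map_le_iff_le_comap.2 hq)
  refine ⟨P.map (tensorQuotientMap k p q),
    Ideal.map_isPrime_of_surjective (tensorQuotientMap_surjective p q) hker, ?_⟩
  rw [Ideal.comap_map_of_surjective' (tensorQuotientMap k p q)
    (tensorQuotientMap_surjective p q), sup_eq_left]
  exact hker

theorem comap_includeLeft_comap_tensorQuotientMap (P : Ideal ((A ⧸ p) ⊗[k] (B ⧸ q))) :
    (P.comap (tensorQuotientMap k p q)).comap (includeLeft : A →ₐ[k] A ⊗[k] B) =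
      (P.comap (includeLeft : A ⧸ p →ₐ[k] (A ⧸ p) ⊗[k] (B ⧸ q))).comap (Ideal.Quotient.mk p) :=
  comap_includeLeft_comap_map _ _ P

theorem comap_includeRight_comap_tensorQuotientMap (P : Ideal ((A ⧸ p) ⊗[k] (B ⧸ q))) :
    (P.comap (tensorQuotientMap k p q)).comap (includeRight : B →ₐ[k] A ⊗[k] B) =
      (P.comap (includeRight : B ⧸ q →ₐ[k] (A ⧸ p) ⊗[k] (B ⧸ q))).comap (Ideal.Quotient.mk q) :=
  comap_includeRight_comap_map _ _ P

theorem resTrdeg_comap_tensorQuotientMap (P : Ideal ((A ⧸ p) ⊗[k] (B ⧸ q))) :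
    resTrdeg k (P.comap (tensorQuotientMap k p q)) = resTrdeg k P :=
  resTrdeg_comap_of_surjective _ (tensorQuotientMap_surjective p q) P

/-- Primes of `A ⊗ B` coming from minimal primes of `A/p ⊗ B/q`. -/
theorem comap_tensorQuotientMap_of_height_eq_zero [hp : p.IsPrime] [hq : q.IsPrime] {d : ℕ}
    (hd : resTrdeg k p = d) (hB : eTrdeg k B ≠ ⊤) (P : Ideal ((A ⧸ p) ⊗[k] (B ⧸ q)))
    [hP : P.IsPrime] (h : P.height = 0) :
    (P.comap (tensorQuotientMap k p q)).comap (includeLeft : A →ₐ[k] A ⊗[k] B) = p ∧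
      (P.comap (tensorQuotientMap k p q)).comap (includeRight : B →ₐ[k] A ⊗[k] B) = q ∧
      resTrdeg k (P.comap (tensorQuotientMap k p q)) = d + resTrdeg k q := by
  obtain ⟨h1, h2⟩ := comap_eq_bot_of_height_eq_zero P h
  refine ⟨?_, ?_, ?_⟩
  · rw [comap_includeLeft_comap_tensorQuotientMap, h1, ← RingHom.ker_eq_comap_bot, Ideal.mk_ker]
  · rw [comap_includeRight_comap_tensorQuotientMap, h2, ← RingHom.ker_eq_comap_bot, Ideal.mk_ker]
  · rw [resTrdeg_comap_tensorQuotientMap]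
    have := height_add_resTrdeg_of_comap_eq_bot hd (eTrdeg_quotient_ne_top hB q) P h1 h2
    rwa [h, zero_add] at this

end Quotient

section LowerBound

open Algebra.TensorProduct

variable {k A T B : Type} [Field k] [CommRing A] [CommRing T] [CommRing B] [Algebra k A]
  [Algebra k T] [Algebra k B] {u : A →ₐ[k] T} {M : Ideal T}

theorem exists_comap_map_eq_of_comap_eq [hM : M.IsMaximal] (hm : resTrdeg k M ≠ ⊤)
    (R : Ideal (A ⊗[k] B)) [hR : R.IsPrime] (hRt : resTrdeg k R ≠ ⊤)
    (hRM : R.comap (includeLeft : A →ₐ[k] A ⊗[k] B) = M.comap u) :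
    ∃ Q : Ideal (T ⊗[k] B), Q.IsPrime ∧ Q.comap (Algebra.TensorProduct.map u (AlgHom.id k B)) = R ∧
      Q.comap (includeLeft : T →ₐ[k] T ⊗[k] B) = M ∧
      resTrdeg k Q ≤ max (resTrdeg k M) (resTrdeg k R) := by
  let _ : Field (T ⧸ M) := Ideal.Quotient.field M
  have : (M.comap u).IsPrime := inferInstance
  let S := (A ⊗[k] B) ⧸ R
  let L := FractionRing S
  let f : A ⧸ M.comap u →ₐ[k] T ⧸ M := Ideal.quotientMapₐ M u le_rfl
  have hf : Function.Injective f := Ideal.quotientMap_injective' (H := le_rfl) le_rfl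
  let g₀ : A ⧸ M.comap u →ₐ[k] S :=
    Ideal.quotientMapₐ R (includeLeft : A →ₐ[k] A ⊗[k] B) hRM.ge
  have hg₀ : Function.Injective g₀ := Ideal.quotientMap_injective' (H := hRM.ge) hRM.le
  let ι : S →ₐ[k] L := IsScalarTower.toAlgHom k S L
  have hι : Function.Injective ι := IsFractionRing.injective S L
  have hL : eTrdeg k L = resTrdeg k R := eTrdeg_fractionRing S
  obtain ⟨Ω, _, _, f', g', hfg, hΩ⟩ := exists_field_algHom_comp_eq f (ι.comp g₀) hf
    (hι.comp hg₀) hm (hL ▸ hRt)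
  let φ : T →ₐ[k] Ω := f'.comp (Ideal.Quotient.mkₐ k M)
  let ψ : A ⊗[k] B →ₐ[k] Ω := (g'.comp ι).comp (Ideal.Quotient.mkₐ k R)
  let χ : T ⊗[k] B →ₐ[k] Ω :=
    productMap φ (ψ.comp (includeRight : B →ₐ[k] A ⊗[k] B))
  have hχ : χ.comp (Algebra.TensorProduct.map u (AlgHom.id k B)) = ψ := by
    ext a
    · have h := DFunLike.congr_fun hfg (Ideal.Quotient.mk _ a)
      have h' : φ (u a) = ψ (a ⊗ₜ 1) := h
      have h1 : ψ (1 ⊗ₜ 1) = 1 := map_one ψ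
      simp [χ, h', h1]
    · simp [χ]
  refine ⟨RingHom.ker χ, RingHom.ker_isPrime _, ?_, ?_, ?_⟩
  · have h1 : (RingHom.ker χ).comap (Algebra.TensorProduct.map u (AlgHom.id k B)) =
        RingHom.ker ψ := by
      rw [← hχ]
      rfl
    rw [h1]
    ext z
    have : ψ z = g' (ι (Ideal.Quotient.mk R z)) := rfl
    rw [RingHom.mem_ker, this, map_eq_zero, ← map_zero ι, hι.eq_iff, Ideal.Quotient.eq_zero_iff_mem]
  · ext x
    have : χ ((includeLeft : T →ₐ[k] T ⊗[k] B) x) = f' (Ideal.Quotient.mk M x) := by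
      have h1 : ψ (1 ⊗ₜ 1) = 1 := map_one ψ
      simp [χ, φ, h1]
    rw [Ideal.mem_comap, RingHom.mem_ker, this, map_eq_zero, Ideal.Quotient.eq_zero_iff_mem]
  · refine (resTrdeg_ker_le χ).trans (hΩ.trans ?_)
    rw [hL]
    rfl

variable [IsDomain A] [IsDomain T]

theorem height_polyExt_add_min_le [hM : M.IsMaximal] {t d m e : ℕ}
    (hu : Function.Injective u) (huM : ∀ x ∈ M, ∃ a, u a = x) (hA : eTrdeg k A = t)
    (hT : eTrdeg k T = t) (hm : resTrdeg k M = m) (hme : m + e = t) (hMe : M.height = e)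
    (hB : eTrdeg k B ≠ ⊤) (R : Ideal (A ⊗[k] B)) [hR : R.IsPrime] {q₁ : Ideal B}
    (hRM : R.comap (includeLeft : A →ₐ[k] A ⊗[k] B) = M.comap u)
    (hRq : R.comap (includeRight : B →ₐ[k] A ⊗[k] B) = q₁)
    (hRt : resTrdeg k R = d + resTrdeg k q₁) :
    (polyExt t q₁).height + min (t : ℕ∞) (e + d + resTrdeg k q₁) ≤ R.height + d := by
  have i1 : resTrdeg k q₁ ≠ ⊤ := ne_top_of_le_ne_top hB (resTrdeg_le_eTrdeg q₁)
  obtain ⟨Q, hQ, hQR, hQM, hQt⟩ := exists_comap_map_eq_of_comap_eq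
    (hm ▸ ENat.natCast_ne_top m) R (hRt ▸ WithTop.add_ne_top.2 ⟨ENat.natCast_ne_top d, i1⟩) hRM
  have hQB : q₁ = Q.comap (includeRight : B →ₐ[k] T ⊗[k] B) := by
    rw [← hRq, ← hQR, comap_includeRight_comap_map_id]
  have h := le_height_comap_add_resTrdeg u hu hA hT hB Q hQM.symm
    (by rw [hMe, hm]; exact_mod_cast (add_comm e m).trans hme) hQB
    (fun Q₁ Q₂ hQ₁ _ hlt hQ₁M ↦ by
      obtain ⟨x, hx, hxQ⟩ := SetLike.exists_of_lt hQ₁M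
      obtain ⟨a, rfl⟩ := huM x hx
      refine comap_map_lt_comap_map u _ (exists_mem_powers_mul_eq huM hx) hlt ?_
      rintro _ ⟨n, rfl⟩ h
      exact hxQ (Ideal.IsPrime.mem_of_pow_mem (I := Ideal.comap u _) inferInstance n h))
  rw [hQR] at h
  rw [hm, hRt] at hQt
  have : q₁.IsPrime := hQB ▸ inferInstance
  have i2 := height_polyExt_ne_top hB t q₁
  rcases eq_or_ne R.height ⊤ with i3 | i3
  · simp [i3]
  have i4 : resTrdeg k Q ≠ ⊤ := ne_top_of_le_ne_top (by
    rcases max_choice (m : ℕ∞) (d + resTrdeg k q₁) with h | h <;> rw [h]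
    exacts [ENat.natCast_ne_top m, WithTop.add_ne_top.2 ⟨ENat.natCast_ne_top d, i1⟩]) hQt
  rw [← min_add_add_left]
  generalize resTrdeg k Q = x₁ at *
  generalize resTrdeg k q₁ = x₂ at *
  generalize R.height = x₃ at *
  generalize (polyExt t q₁).height = x₄ at *
  clear hRt
  lift x₁ to ℕ using i4
  lift x₂ to ℕ using i1
  lift x₃ to ℕ using i3
  lift x₄ to ℕ using i2
  rcases le_max_iff.1 hQt with hQt | hQt
  · refine min_le_of_right_le ?_
    clear hm hMe hA hT hB
    norm_cast at *
    omega
  · refine min_le_of_left_le ?_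
    clear hm hMe hA hT hB
    norm_cast at *
    omega

/-- Lower bound for the height of a prime of `A ⊗ B` over the conductor of a pullback `A`. -/
theorem resTrdeg_add_conductorBound_le [hM : M.IsMaximal] {t d m e : ℕ}
    (hu : Function.Injective u) (huM : ∀ x ∈ M, ∃ a, u a = x) (hA : eTrdeg k A = t)
    (hT : eTrdeg k T = t) (hm : resTrdeg k M = m) (hme : m + e = t) (hMe : M.height = e)
    (hd : resTrdeg k (M.comap u) = d)
    (hAF : ∀ p : Ideal (A ⧸ M.comap u), p.IsPrime → p.height + resTrdeg k p = d)
    (hB : eTrdeg k B ≠ ⊤) (P : Ideal (A ⊗[k] B)) [hP : P.IsPrime]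
    (hPM : M.comap u ≤ P.comap (includeLeft : A →ₐ[k] A ⊗[k] B)) (q₁ : Ideal B) [hq₁ : q₁.IsPrime]
    (hq₁P : q₁ ≤ P.comap (includeRight : B →ₐ[k] A ⊗[k] B)) :
    resTrdeg k (P.comap (includeRight : B →ₐ[k] A ⊗[k] B)) +
        conductorBound k t d e q₁ (P.comap (includeRight : B →ₐ[k] A ⊗[k] B)) ≤
      P.height + resTrdeg k P := by
  have : (M.comap u).IsPrime := inferInstance
  obtain ⟨P', hP', rfl⟩ := exists_comap_tensorQuotientMap_eq P hPM hq₁P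
  set c : ℕ∞ := (polyExt t q₁).height + min (t : ℕ∞) (e + d + resTrdeg k q₁) - d with hc
  have hc' : (polyExt t q₁).height + min (t : ℕ∞) (e + d + resTrdeg k q₁) ≤ c + d := le_tsub_add
  have h1 := height_comap_add_le_height_comap_of_flat (RingHom.id _) (RingHom.Flat.id _)
    (tensorQuotientMap k (M.comap u) q₁).toRingHom P' (c := c)
    (fun Q₁ Q₂ _ _ hlt _ _ ↦ lt_of_le_of_ne (Ideal.comap_mono hlt.le) fun h ↦ hlt.ne
      (Ideal.comap_injective_of_surjective _ (tensorQuotientMap_surjective _ _) h))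
    (fun Q hQ _ h ↦ by
      rw [Ideal.comap_id] at h
      obtain ⟨h2, h3, h4⟩ := comap_tensorQuotientMap_of_height_eq_zero hd hB Q h
      exact tsub_le_iff_right.2 (height_polyExt_add_min_le hu huM hA hT hm hme hMe hB _ h2 h3 h4))
  rw [Ideal.comap_id] at h1
  have h1 : P'.height + c ≤ (P'.comap (tensorQuotientMap k (M.comap u) q₁)).height := h1
  have h2 := height_add_resTrdeg_eq hd (eTrdeg_quotient_ne_top hB q₁) P' (hAF _ (hP'.comap _))
  rw [comap_includeRight_comap_tensorQuotientMap, resTrdeg_comap_tensorQuotientMap, conductorBound,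
    Ideal.map_comap_of_surjective _ Ideal.Quotient.mk_surjective]
  have h3 : resTrdeg k ((P'.comap (includeRight : B ⧸ q₁ →ₐ[k] (A ⧸ M.comap u) ⊗[k] (B ⧸ q₁))).comap
      (Ideal.Quotient.mk q₁)) = resTrdeg k (P'.comap
        (includeRight : B ⧸ q₁ →ₐ[k] (A ⧸ M.comap u) ⊗[k] (B ⧸ q₁))) :=
    resTrdeg_comap_of_surjective (Ideal.Quotient.mkₐ k q₁) (Ideal.Quotient.mkₐ_surjective k q₁) _
  rw [h3]
  calc _ = resTrdeg k (P'.comap (includeRight : B ⧸ q₁ →ₐ[k] (A ⧸ M.comap u) ⊗[k] (B ⧸ q₁))) +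
        (polyExt d (P'.comap
          (includeRight : B ⧸ q₁ →ₐ[k] (A ⧸ M.comap u) ⊗[k] (B ⧸ q₁)))).height +
        ((polyExt t q₁).height + min (t : ℕ∞) (e + d + resTrdeg k q₁)) := by ring
    _ ≤ _ + (c + d) := add_le_add_right hc' _
    _ = P'.height + c + resTrdeg k P' := by
      rw [add_right_comm P'.height, h2]
      ring
    _ ≤ _ := add_le_add_left h1 _

end LowerBound

section Assembly

open Algebra.TensorProduct

theorem idealHt_eq_height {R : Type} [CommRing R] (I : Ideal R) : idealHt I = I.height := by
  refine le_antisymm ?_ (le_iInf fun P ↦ ?_)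
  · rw [Ideal.height_eq_inf_minimalPrimes]
    refine le_iInf₂ fun J hJ ↦ ?_
    have := PrimeSpectrum.height_eq_orderHeight ⟨J, hJ.1.1⟩
    exact (iInf_le (fun P : {P : PrimeSpectrum R // I ≤ P.asIdeal} ↦ Order.height P.1)
      ⟨⟨J, hJ.1.1⟩, hJ.1.2⟩).trans this.ge
  · rw [← PrimeSpectrum.height_eq_orderHeight]
    exact Ideal.height_mono P.2

variable {k A B : Type} [Field k] [CommRing A] [CommRing B] [Algebra k A] [Algebra k B]

theorem height_add_resTrdeg_comap_algEquiv (e : A ≃ₐ[k] B) (p : Ideal B) :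
    (p.comap (e : A →ₐ[k] B)).height + resTrdeg k (p.comap (e : A →ₐ[k] B)) =
      p.height + resTrdeg k p := by
  rw [resTrdeg_comap_of_surjective (e : A →ₐ[k] B) e.surjective]
  congr 1
  exact e.toRingEquiv.height_comap p

theorem height_add_resTrdeg_eq_of_algEquiv {d : ℕ∞} (e : A ≃ₐ[k] B)
    (h : ∀ p : Ideal A, p.IsPrime → p.height + resTrdeg k p = d) (p : Ideal B) (hp : p.IsPrime) :
    p.height + resTrdeg k p = d := by
  rw [← height_add_resTrdeg_comap_algEquiv e]
  exact h _ (hp.comap _)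

/-- If `ht P + t.d.((A ⊗ B)/P)` depends only on the contractions of `P` to `A` and `B`, then
heights in `A ⊗ B` satisfy the special chain formula. -/
theorem height_eq_height_add_height_map [IsDomain A] {t : ℕ} (hA : eTrdeg k A = t)
    (hB : eTrdeg k B ≠ ⊤)
    (hF : ∀ P₁ P₂ : Ideal (A ⊗[k] B), P₁.IsPrime → P₂.IsPrime →
      P₁.comap (includeLeft : A →ₐ[k] A ⊗[k] B) = P₂.comap (includeLeft : A →ₐ[k] A ⊗[k] B) →
      P₁.comap (includeRight : B →ₐ[k] A ⊗[k] B) = P₂.comap (includeRight : B →ₐ[k] A ⊗[k] B) →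
      P₁.height + resTrdeg k P₁ ≤ P₂.height + resTrdeg k P₂)
    (P : Ideal (A ⊗[k] B)) [hP : P.IsPrime] {p : Ideal A} {q : Ideal B}
    (hp : p = P.comap (includeLeft : A →ₐ[k] A ⊗[k] B))
    (hq : q = P.comap (includeRight : B →ₐ[k] A ⊗[k] B)) :
    P.height =
      (p.map (includeLeft : A →ₐ[k] A ⊗[k] B) ⊔ q.map (includeRight : B →ₐ[k] A ⊗[k] B)).height +
      (P.map (Ideal.Quotient.mk (p.map (includeLeft : A →ₐ[k] A ⊗[k] B) ⊔
        q.map (includeRight : B →ₐ[k] A ⊗[k] B)))).height := by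
  have hpp : p.IsPrime := hp ▸ inferInstance
  have hqp : q.IsPrime := hq ▸ inferInstance
  obtain ⟨d, hd⟩ := ENat.ne_top_iff_exists.1 (ne_top_of_le_ne_top (ENat.natCast_ne_top t)
    (hA ▸ resTrdeg_le_eTrdeg p))
  have hqt : resTrdeg k q ≠ ⊤ := ne_top_of_le_ne_top hB (resTrdeg_le_eTrdeg q)
  have hs : (d : ℕ∞) + resTrdeg k q ≠ ⊤ := WithTop.add_ne_top.2 ⟨ENat.natCast_ne_top d, hqt⟩
  rw [← ker_tensorQuotientMap]
  set G := tensorQuotientMap k p q with hG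
  have hGs : Function.Surjective G := tensorQuotientMap_surjective p q
  obtain ⟨P', hP', hPP'⟩ := exists_comap_tensorQuotientMap_eq P hp.le hq.le
  have hquot : (P.map (Ideal.Quotient.mk (RingHom.ker G))).height = P'.height := by
    let e : (A ⊗[k] B) ⧸ RingHom.ker G ≃+* (A ⧸ p) ⊗[k] (B ⧸ q) :=
      RingHom.quotientKerEquivOfSurjective (f := G.toRingHom) hGs
    rw [← e.height_comap P']
    congr 1
    rw [← hPP']
    change Ideal.map _ ((P'.comap e).comap (Ideal.Quotient.mk (RingHom.ker G))) = _
    exact Ideal.map_comap_of_surjective _ Ideal.Quotient.mk_surjective _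
  have hP't : P'.height + resTrdeg k P = d + resTrdeg k q := by
    have hl : P'.comap (includeLeft : A ⧸ p →ₐ[k] (A ⧸ p) ⊗[k] (B ⧸ q)) = ⊥ := by
      have h := comap_includeLeft_comap_tensorQuotientMap P'
      rw [hPP', ← hp] at h
      rw [← Ideal.map_comap_of_surjective _ Ideal.Quotient.mk_surjective (P'.comap _), ← h,
        Ideal.map_quotient_self]
    have hr : P'.comap (includeRight : B ⧸ q →ₐ[k] (A ⧸ p) ⊗[k] (B ⧸ q)) = ⊥ := by
      have h := comap_includeRight_comap_tensorQuotientMap P'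
      rw [hPP', ← hq] at h
      rw [← Ideal.map_comap_of_surjective _ Ideal.Quotient.mk_surjective (P'.comap _), ← h,
        Ideal.map_quotient_self]
    rw [← hPP', resTrdeg_comap_tensorQuotientMap]
    exact height_add_resTrdeg_of_comap_eq_bot hd.symm (eTrdeg_quotient_ne_top hB q) P' hl hr
  -- minimal primes of the kernel
  have hmin (R : Ideal (A ⊗[k] B)) (hR : R.IsPrime) (hRG : RingHom.ker G ≤ R) :
      ∃ R₀ : Ideal (A ⊗[k] B), RingHom.ker G ≤ R₀ ∧ R₀ ≤ R ∧
        R₀.height + (d + resTrdeg k q) = P.height + resTrdeg k P := by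
    rw [ker_tensorQuotientMap, sup_le_iff, Ideal.map_le_iff_le_comap,
      Ideal.map_le_iff_le_comap] at hRG
    obtain ⟨R', hR', rfl⟩ := exists_comap_tensorQuotientMap_eq R hRG.1 hRG.2
    obtain ⟨Q, hQ, hQR⟩ := Ideal.exists_minimalPrimes_le (bot_le : ⊥ ≤ R')
    have hQp : Q.IsPrime := hQ.1.1
    obtain ⟨h1, h2, h3⟩ := comap_tensorQuotientMap_of_height_eq_zero hd.symm hB Q
      (Ideal.height_eq_zero_iff.2 hQ)
    refine ⟨_, Ideal.comap_mono bot_le, Ideal.comap_mono hQR, ?_⟩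
    rw [← h3]
    exact le_antisymm (hF _ _ (hQp.comap G) hP (h1.trans hp) (h2.trans hq))
      (hF _ _ hP (hQp.comap G) (h1.trans hp).symm (h2.trans hq).symm)
  obtain ⟨R₀, hR₀, -, hR₀t⟩ := hmin P hP (hPP' ▸ Ideal.comap_mono bot_le)
  have hker : (RingHom.ker G).height = R₀.height := by
    refine le_antisymm (Ideal.height_mono hR₀) ?_
    rw [Ideal.height_eq_inf_minimalPrimes (RingHom.ker G)]
    refine le_iInf₂ fun R hR ↦ ?_
    obtain ⟨R₁, -, hR₁, hR₁t⟩ := hmin R hR.1.1 hR.1.2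
    exact ((ENat.add_le_add_iff_right hs).1 (hR₀t.trans hR₁t.symm).le).trans
      (Ideal.height_mono hR₁)
  rw [hquot, hker]
  have hPt : resTrdeg k P ≠ ⊤ := ne_top_of_le_ne_top hs (hP't ▸ le_add_self)
  have h : P.height + resTrdeg k P = R₀.height + P'.height + resTrdeg k P := by
    rw [← hR₀t, ← hP't, add_assoc]
  exact le_antisymm ((ENat.add_le_add_iff_right hPt).1 h.le)
    ((ENat.add_le_add_iff_right hPt).1 h.ge)

variable {T : Type} [CommRing T] [Algebra k T] {u : A →ₐ[k] T} {M : Ideal T}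

theorem height_add_resTrdeg_le_of_comap_eq [IsDomain A] [IsDomain T] [hM : M.IsMaximal] {t : ℕ}
    {d : ℕ∞} (hu : Function.Injective u) (huM : ∀ x ∈ M, ∃ a, u a = x) (hA : eTrdeg k A = t)
    (hT : eTrdeg k T = t) (hTAF : ∀ p : Ideal T, p.IsPrime → p.height + resTrdeg k p = t)
    (hAF : ∀ p : Ideal (A ⧸ M.comap u), p.IsPrime → p.height + resTrdeg k p = d)
    (hB : eTrdeg k B ≠ ⊤) (P₁ P₂ : Ideal (A ⊗[k] B)) (hP₁ : P₁.IsPrime) (hP₂ : P₂.IsPrime)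
    (hl : P₁.comap (includeLeft : A →ₐ[k] A ⊗[k] B) =
      P₂.comap (includeLeft : A →ₐ[k] A ⊗[k] B))
    (hr : P₁.comap (includeRight : B →ₐ[k] A ⊗[k] B) =
      P₂.comap (includeRight : B →ₐ[k] A ⊗[k] B)) :
    P₁.height + resTrdeg k P₁ ≤ P₂.height + resTrdeg k P₂ := by
  by_cases hPM : M.comap u ≤ P₁.comap (includeLeft : A →ₐ[k] A ⊗[k] B)
  · have : (M.comap u).IsPrime := inferInstance
    have hd : resTrdeg k (M.comap u) = d := by
      rw [← hAF ⊥ Ideal.isPrime_bot, Ideal.height_bot, resTrdeg_bot, zero_add]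
      rfl
    have hMt := hTAF M hM.isPrime
    obtain ⟨m, hm⟩ := ENat.ne_top_iff_exists.1 (ne_top_of_le_ne_top (ENat.natCast_ne_top t)
      (hMt ▸ le_add_self : resTrdeg k M ≤ t))
    obtain ⟨e, he⟩ := ENat.ne_top_iff_exists.1 (ne_top_of_le_ne_top (ENat.natCast_ne_top t)
      (hMt ▸ le_self_add : M.height ≤ t))
    have hme : m + e = t := by
      rw [← hm, ← he] at hMt
      rw [add_comm]
      exact_mod_cast hMt
    lift d to ℕ using ne_top_of_le_ne_top (ENat.natCast_ne_top t)
      (hd ▸ hA ▸ resTrdeg_le_eTrdeg (M.comap u))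
    obtain ⟨q₁, hq₁, hq₁P, h⟩ := exists_height_add_resTrdeg_le hu huM hA hm.symm hme hd hB P₁ hPM
    rw [hl] at hPM
    rw [hr] at hq₁P h
    exact h.trans (resTrdeg_add_conductorBound_le hu huM hA hT hm.symm hme he.symm hd hAF hB P₂ hPM
      q₁ hq₁P)
  · rw [height_add_resTrdeg_eq_of_not_le hu huM hA hT hTAF hB P₁ hPM, hr]
    rw [hl] at hPM
    rw [height_add_resTrdeg_eq_of_not_le hu huM hA hT hTAF hB P₂ hPM]

theorem isGAFDomain_of_conductor [IsDomain A] [IsDomain T] [hM : M.IsMaximal] {t : ℕ} {d : ℕ∞}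
    (hu : Function.Injective u) (huM : ∀ x ∈ M, ∃ a, u a = x) (hT : eTrdeg k T = t)
    (hTAF : ∀ p : Ideal T, p.IsPrime → p.height + resTrdeg k p = t)
    (hAF : ∀ p : Ideal (A ⧸ M.comap u), p.IsPrime → p.height + resTrdeg k p = d) :
    IsGAFDomain k A := by
  intro B _ _ hB P hP p hp q hq
  simp only [idealHt_eq_height]
  obtain ⟨s, hs⟩ := ENat.ne_top_iff_exists.1 (ne_top_of_le_ne_top (ENat.natCast_ne_top t)
    (hT ▸ eTrdeg_le_of_injective u hu))
  refine height_eq_height_add_height_map hs.symm hB ?_ P hp hq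
  rcases eq_or_ne M ⊥ with rfl | hM0
  · have hbot : Ideal.comap u ⊥ = ⊥ := by
      rw [← RingHom.ker_eq_comap_bot]
      exact (RingHom.injective_iff_ker_eq_bot u).1 hu
    have hA (p : Ideal A) (hp : p.IsPrime) : p.height + resTrdeg k p = s := by
      have e : (A ⧸ Ideal.comap u ⊥) ≃ₐ[k] A :=
        (Ideal.quotientEquivAlgOfEq k hbot).trans (AlgEquiv.quotientBot k A)
      have h := height_add_resTrdeg_eq_of_algEquiv e hAF
      rw [h p hp, hs, ← h ⊥ Ideal.isPrime_bot, Ideal.height_bot, resTrdeg_bot, zero_add]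
    intro P₁ P₂ _ _ _ hr
    rw [height_add_resTrdeg_eq hs.symm hB P₁ (hA _ inferInstance),
      height_add_resTrdeg_eq hs.symm hB P₂ (hA _ inferInstance), hr]
  · obtain ⟨x, hx, hx0⟩ := Submodule.exists_mem_ne_zero_of_ne_bot hM0
    obtain ⟨a, rfl⟩ := huM x hx
    have hA : eTrdeg k A = t := le_antisymm (hT ▸ eTrdeg_le_of_injective u hu)
      (hT ▸ eTrdeg_le_of_forall_exists_mul u fun y ↦ by
        obtain ⟨b, hb⟩ := huM _ (M.mul_mem_right y hx)
        exact ⟨a, b, hx0, hb.symm⟩)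
    have hst : s = t := by rw [← hs] at hA; exact_mod_cast hA
    subst hst
    exact height_add_resTrdeg_le_of_comap_eq hu huM hA hT hTAF hAF hB

end Assembly

/-- the pullback `A = φ⁻¹(D)` with `T`, `D` AF-domains and `T_M`
catenarian is a GAF-domain. -/
theorem stmt_13 (k T : Type) [Field k] [CommRing T] [IsDomain T] [Algebra k T]
    (hTfin : eTrdeg k T ≠ ⊤)
    (M : Ideal T) [hM : M.IsMaximal]
    (D : Subalgebra k (T ⧸ M))
    (A : Subalgebra k T) (hA : A = D.comap (Ideal.Quotient.mkₐ k M))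
    (hTAF : IsAFDomain k T) (hDAF : IsAFDomain k ↥D)
    (hcat : IsCatenarian (Localization.AtPrime M)) :
    IsGAFDomain k ↥A := by
  obtain ⟨t, ht⟩ := ENat.ne_top_iff_exists.1 hTfin
  subst hA
  let π : D.comap (Ideal.Quotient.mkₐ k M) →ₐ[k] D :=
    ((Ideal.Quotient.mkₐ k M).comp (Subalgebra.val _)).codRestrict D fun a ↦ a.2
  have hπ : Function.Surjective π := by
    rintro ⟨y, hy⟩
    obtain ⟨x, rfl⟩ := Ideal.Quotient.mk_surjective y
    exact ⟨⟨x, hy⟩, rfl⟩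
  have hker : RingHom.ker π = M.comap (Subalgebra.val (D.comap (Ideal.Quotient.mkₐ k M))) := by
    ext a
    rw [RingHom.mem_ker, ← Subtype.coe_inj]
    exact Ideal.Quotient.eq_zero_iff_mem
  have e := (Ideal.quotientEquivAlgOfEq k hker.symm).trans (Ideal.quotientKerAlgEquivOfSurjective hπ)
  have hD (p : Ideal D) (hp : p.IsPrime) : p.height + resTrdeg k p = eTrdeg k D := by
    rw [← idealHt_eq_height]
    exact hDAF p hp
  have hT (p : Ideal T) (hp : p.IsPrime) : p.height + resTrdeg k p = t := by
    rw [ht, ← idealHt_eq_height]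
    exact hTAF p hp
  have huM (x : T) (hx : x ∈ M) :
      ∃ a, Subalgebra.val (D.comap (Ideal.Quotient.mkₐ k M)) a = x := by
    refine ⟨⟨x, ?_⟩, rfl⟩
    change Ideal.Quotient.mk M x ∈ D
    rw [Ideal.Quotient.eq_zero_iff_mem.2 hx]
    exact zero_mem D
  have hAF := height_add_resTrdeg_eq_of_algEquiv e.symm hD
  exact isGAFDomain_of_conductor Subtype.val_injective huM ht.symm hT hAF
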